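/- arXiv:1807.02379 — 7 statements merged into one kernel-verified Lean document; each statement's English description precedes it below -/
import Mathlib

section
/- Let f ∈ A be non-constant with n = deg f, P ∈ A monic irreducible of degree d, and e ≥ 1. Then the number N(f, P^e) of polynomial functions from A_f to A_{P^e} equals |P|^{e q^n − Σ_{k=1}^{q^n−1} min{e, ⌊k/q^d⌋ + ⌊k/q^{2d}⌋ + ⌊k/q^{3d}⌋ + ⋯}}. -/
open Polynomial

noncomputable section

variable {F : Type*} [Field F] [Fintype F]

/-- `σ : A_f → A_g` is congruence preserving: for all `h₁, h₂` in the complete set of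
representatives `𝒜_f = {h : deg h < deg f} ∪ {0}` and all `h ∣ g`, if `h₁ ≡ h₂ (mod h)`
then `σ(h̄₁) ≡ σ(h̄₂) (mod h)` (expressed via arbitrary representatives of the values). -/
def IsCongPres (f g : Polynomial F)
    (σ : (Polynomial F ⧸ Ideal.span {f}) → Polynomial F ⧸ Ideal.span {g}) : Prop :=
  ∀ h₁ h₂ h : Polynomial F, h₁.degree < f.degree → h₂.degree < f.degree →
    h ∣ g → h ∣ h₁ - h₂ →
    ∀ s₁ s₂ : Polynomial F,
      Ideal.Quotient.mk (Ideal.span {g}) s₁ = σ (Ideal.Quotient.mk (Ideal.span {f}) h₁) →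
      Ideal.Quotient.mk (Ideal.span {g}) s₂ = σ (Ideal.Quotient.mk (Ideal.span {f}) h₂) →
      h ∣ s₁ - s₂

/-- `σ : A_f → A_g` is a polynomial function: representable by some `G ∈ A[x]` on the
representatives of degree `< deg f`. -/
def IsPolyFun (f g : Polynomial F)
    (σ : (Polynomial F ⧸ Ideal.span {f}) → Polynomial F ⧸ Ideal.span {g}) : Prop :=
  ∃ G : Polynomial (Polynomial F),
    ∀ h : Polynomial F, h.degree < f.degree →
      σ (Ideal.Quotient.mk (Ideal.span {f}) h) = Ideal.Quotient.mk (Ideal.span {g}) (G.eval h)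

/-- `(f, g)` is a Chen pair: every congruence preserving function `A_f → A_g`
is a polynomial function. -/
def IsChenPair (f g : Polynomial F) : Prop :=
  ∀ σ : (Polynomial F ⧸ Ideal.span {f}) → Polynomial F ⧸ Ideal.span {g},
    IsCongPres f g σ → IsPolyFun f g σ

/-- The base-`Q` digits of `k`, mapped through `c`, used as coefficients of an expansion in
powers of `u`. -/
def digitExpansion {R : Type*} [CommRing R] (c : ℕ → R) (u : R) (Q k : ℕ) : R :=
  (Nat.digits Q k).foldr (fun r y => c r + u * y) 0

theorem digitExpansion_zero {R : Type*} [CommRing R] (c : ℕ → R) (u : R) (Q : ℕ) :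
    digitExpansion c u Q 0 = 0 := by
  simp [digitExpansion]

theorem digitExpansion_eq {R : Type*} [CommRing R] {c : ℕ → R} (u : R) {Q : ℕ} (hQ : 1 < Q)
    (hc : c 0 = 0) (k : ℕ) :
    digitExpansion c u Q k = c (k % Q) + u * digitExpansion c u Q (k / Q) := by
  rcases Nat.eq_zero_or_pos k with rfl | hk
  · simp [digitExpansion, hc]
  · simp only [digitExpansion, Nat.digits_def' hQ hk, List.foldr_cons]

theorem digitExpansion_injective {R : Type*} [CommRing R] [IsDomain R] {c : ℕ → R} {u : R}
    (hu : u ≠ 0) {Q : ℕ} (hQ : 1 < Q) (hc : c 0 = 0)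
    (hinj : ∀ r < Q, ∀ s < Q, u ∣ c r - c s → r = s) :
    Function.Injective (digitExpansion c u Q) := by
  have key : ∀ B i j : ℕ, i ≤ B → j ≤ B →
      digitExpansion c u Q i = digitExpansion c u Q j → i = j := by
    intro B
    induction B with
    | zero => intro i j hi hj _; omega
    | succ B ih =>
      intro i j hi hj h
      rw [digitExpansion_eq u hQ hc i, digitExpansion_eq u hQ hc j] at h
      have hmod : i % Q = j % Q := by
        refine hinj _ (Nat.mod_lt _ (by omega)) _ (Nat.mod_lt _ (by omega))
          ⟨digitExpansion c u Q (j / Q) - digitExpansion c u Q (i / Q), ?_⟩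
        linear_combination h
      rw [hmod] at h
      have hle : ∀ m ≤ B + 1, m / Q ≤ B := fun m hm => by
        rcases Nat.eq_zero_or_pos m with rfl | h0
        · simp
        · have := Nat.div_lt_self h0 hQ
          omega
      have hdiv := ih _ _ (hle i hi) (hle j hj) (mul_left_cancel₀ hu (add_left_cancel h))
      rw [← Nat.div_add_mod i Q, ← Nat.div_add_mod j Q, hmod, hdiv]
  exact fun i j h => key (max i j) i j (le_max_left _ _) (le_max_right _ _) h

/-- If `c` maps numbers below `q ^ r` to degrees below `r` for `r ≤ deg u`, the same holds for the
expansion in powers of `u` with digits in base `q ^ deg u`, without restriction on `r`. -/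
theorem degree_digitExpansion_lt {K : Type*} [Field K] {c : ℕ → K[X]} {u : K[X]} {q : ℕ}
    (hq : 1 < q) (hu : 0 < u.natDegree) (hc0 : c 0 = 0)
    (hc : ∀ r ≤ u.natDegree, ∀ k < q ^ r, (c k).degree < r) (n : ℕ) :
    ∀ k < q ^ n, (digitExpansion c u (q ^ u.natDegree) k).degree < n := by
  have hQ : 1 < q ^ u.natDegree := Nat.one_lt_pow hu.ne' hq
  induction n using Nat.strong_induction_on with
  | _ n ih =>
    intro k hk
    rw [digitExpansion_eq u hQ hc0]
    rcases le_total n u.natDegree with hn | hn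
    · have hkQ : k < q ^ u.natDegree := hk.trans_le (Nat.pow_le_pow_right (by omega) hn)
      rw [Nat.div_eq_of_lt hkQ, digitExpansion_zero, mul_zero, add_zero, Nat.mod_eq_of_lt hkQ]
      exact hc n hn k hk
    · have h1 : (c (k % q ^ u.natDegree)).degree < n :=
        (hc _ le_rfl _ (Nat.mod_lt _ (by omega))).trans_le (by exact_mod_cast hn)
      have h2 : k / q ^ u.natDegree < q ^ (n - u.natDegree) := by
        rw [Nat.div_lt_iff_lt_mul (by omega), ← pow_add, Nat.sub_add_cancel hn]
        exact hk
      have h3 := ih (n - u.natDegree) (by omega) _ h2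
      refine (degree_add_le _ _).trans_lt (max_lt h1 ?_)
      rw [degree_mul, degree_eq_natDegree (ne_zero_of_natDegree_gt hu)]
      rcases eq_or_ne (digitExpansion c u (q ^ u.natDegree) (k / q ^ u.natDegree)) 0 with h0 | h0
      · simp [h0]
      · rw [degree_eq_natDegree h0] at h3 ⊢
        have h4 := Nat.cast_lt.1 h3
        rw [← Nat.cast_add, Nat.cast_lt]
        omega

theorem natCard_degree_lt {K : Type*} [Field K] [Fintype K] (n : ℕ) :
    Nat.card (degreeLT K n) = Fintype.card K ^ n := by
  rw [Nat.card_congr (degreeLTEquiv K n).toEquiv]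
  simp

theorem exists_eq_of_degree_lt {K : Type*} [Field K] [Fintype K] {a : ℕ → K[X]} {n : ℕ}
    (ha : Function.Injective a) (hdeg : ∀ k < Fintype.card K ^ n, (a k).degree < n)
    {h : K[X]} (hh : h.degree < n) : ∃ k < Fintype.card K ^ n, a k = h := by
  let φ : Fin (Fintype.card K ^ n) → degreeLT K n :=
    fun k => ⟨a k, mem_degreeLT.2 (hdeg k k.2)⟩
  have hφ : Function.Injective φ := fun i j hij => Fin.ext (ha (congrArg Subtype.val hij))
  have : Finite (degreeLT K n) := Finite.of_equiv _ (degreeLTEquiv K n).toEquiv.symm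
  have hb : Function.Bijective φ :=
    (Nat.bijective_iff_injective_and_card φ).2 ⟨hφ, by rw [natCard_degree_lt, Nat.card_fin]⟩
  obtain ⟨k, hk⟩ := hb.2 ⟨h, mem_degreeLT.2 hh⟩
  exact ⟨k, k.2, congrArg Subtype.val hk⟩

/-- An enumeration of `K[X]` which lists, for each `n`, the polynomials of degree less than `n`
in the first `q ^ n` places. -/
theorem exists_enumeration (K : Type*) [Field K] [Fintype K] :
    ∃ b : ℕ → K[X], b 0 = 0 ∧ Function.Injective b ∧
      ∀ n : ℕ, ∀ k < Fintype.card K ^ n, (b k).degree < n := by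
  have hq : 1 < Fintype.card K := Fintype.one_lt_card
  let ε : ℕ → K := fun k =>
    if h : k < Fintype.card K then
      (Fintype.equivFin K).symm ⟨k, h⟩ - (Fintype.equivFin K).symm ⟨0, by omega⟩ else 0
  have hε0 : ε 0 = 0 := by simp [ε]
  have hε : ∀ r < Fintype.card K, ∀ s < Fintype.card K, ε r = ε s → r = s := by
    intro r hr s hs h
    simpa [ε, hr, hs] using h
  have hC0 : (fun k => C (ε k)) 0 = 0 := by simp [hε0]
  refine ⟨digitExpansion (fun k => C (ε k)) X (Fintype.card K), digitExpansion_zero _ _ _,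
    digitExpansion_injective X_ne_zero hq hC0 ?_, ?_⟩
  · intro r hr s hs h
    refine hε r hr s hs (sub_eq_zero.1 ?_)
    rwa [← C_sub, X_dvd_iff, coeff_C_zero] at h
  · intro n
    have := degree_digitExpansion_lt (c := fun k => C (ε k)) (u := X) hq (by simp) hC0 ?_ n
    · simpa using this
    · intro r hr k hk
      rw [natDegree_X] at hr
      interval_cases r
      · have : k = 0 := by simpa using hk
        simp [this, hε0]
      · exact degree_C_le.trans_lt (by norm_num)

/-- Legendre's sum `⌊k/Q⌋ + ⌊k/Q²⌋ + ⋯`. -/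
def legendreSum (Q k : ℕ) : ℕ := ∑ j ∈ Finset.Icc 1 k, k / Q ^ j

theorem legendreSum_eq {Q : ℕ} (hQ : 1 < Q) {k : ℕ} (hk : 0 < k) :
    legendreSum Q k = k / Q + legendreSum Q (k / Q) := by
  obtain ⟨m, rfl⟩ : ∃ m, k = m + 1 := ⟨k - 1, by omega⟩
  have hlt : (m + 1) / Q < m + 1 := Nat.div_lt_self hk hQ
  have hrange : ∀ (n : ℕ) (g : ℕ → ℕ),
      ∑ j ∈ Finset.Icc 1 n, g j = ∑ j ∈ Finset.range n, g (j + 1) := fun n g => by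
    rw [Finset.range_eq_Ico, Finset.sum_Ico_add' g 0 n 1]
    rfl
  simp only [legendreSum, hrange]
  rw [Finset.sum_range_succ']
  simp only [zero_add, pow_one]
  rw [add_comm]
  congr 1
  simp only [pow_succ' Q (_ + 1), ← Nat.div_div_eq_div_mul]
  refine (Finset.sum_subset (Finset.range_mono (by omega)) fun j _ hj => ?_).symm
  refine Nat.div_eq_of_lt ?_
  have h1 := Nat.lt_pow_self hQ (n := j + 1)
  simp only [Finset.mem_range] at hj
  omega

theorem pow_legendreSum_dvd_prod {R : Type*} [CommRing R] {c : ℕ → R} {u : R} {Q : ℕ}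
    (hQ : 1 < Q) (hc : c 0 = 0) (hsurj : ∀ x, ∃ r < Q, u ∣ x - c r) (k : ℕ) (x : R) :
    u ^ legendreSum Q k ∣ ∏ i ∈ Finset.range k, (x - digitExpansion c u Q i) := by
  induction k using Nat.strong_induction_on generalizing x with
  | _ k ih =>
    rcases Nat.eq_zero_or_pos k with rfl | hk
    · simp [legendreSum]
    obtain ⟨r, hr, y, hy⟩ := hsurj x
    have hterm : ∀ m, x - digitExpansion c u Q (Q * m + r)
        = u * (y - digitExpansion c u Q m) := fun m => by
      rw [digitExpansion_eq u hQ hc, Nat.mul_add_mod, Nat.mod_eq_of_lt hr, Nat.mul_add_div (by omega),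
        Nat.div_eq_of_lt hr, add_zero]
      linear_combination hy
    rw [legendreSum_eq hQ hk, pow_add]
    have hsub : (Finset.range (k / Q)).image (fun m => Q * m + r) ⊆ Finset.range k := by
      intro i hi
      obtain ⟨m, hm, rfl⟩ := Finset.mem_image.1 hi
      rw [Finset.mem_range] at *
      have h1 : Q * (m + 1) ≤ Q * (k / Q) := Nat.mul_le_mul_left _ hm
      have h2 := Nat.mul_div_le k Q
      rw [Nat.mul_add] at h1
      omega
    refine dvd_trans ?_ (Finset.prod_dvd_prod_of_subset _ _ _ hsub)
    rw [Finset.prod_image (fun i _ j _ h => Nat.eq_of_mul_eq_mul_left (by omega : 0 < Q)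
      (Nat.add_right_cancel h))]
    simp only [hterm, Finset.prod_mul_distrib, Finset.prod_const, Finset.card_range]
    exact mul_dvd_mul_left _ (ih _ (Nat.div_lt_self hk hQ) y)

theorem prod_sub_digitExpansion_self {R : Type*} [CommRing R] {c : ℕ → R} {u : R}
    (hu : Prime u) {Q : ℕ} (hQ : 1 < Q) (hc : c 0 = 0)
    (hinj : ∀ r < Q, ∀ s < Q, u ∣ c r - c s → r = s) (k : ℕ) :
    ∃ v, ¬ u ∣ v ∧ ∏ i ∈ Finset.range k, (digitExpansion c u Q k - digitExpansion c u Q i)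
      = u ^ legendreSum Q k * v := by
  induction k using Nat.strong_induction_on with
  | _ k ih =>
    rcases Nat.eq_zero_or_pos k with rfl | hk
    · exact ⟨1, hu.not_dvd_one, by simp [legendreSum]⟩
    obtain ⟨v, hv, hprod⟩ := ih _ (Nat.div_lt_self hk hQ)
    have hr : k % Q < Q := Nat.mod_lt _ (by omega)
    have hterm : ∀ m, digitExpansion c u Q k - digitExpansion c u Q (Q * m + k % Q)
        = u * (digitExpansion c u Q (k / Q) - digitExpansion c u Q m) := fun m => by
      rw [digitExpansion_eq u hQ hc k, digitExpansion_eq u hQ hc (Q * m + k % Q), Nat.mul_add_mod,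
        Nat.mod_eq_of_lt hr, Nat.mul_add_div (by omega), Nat.div_eq_of_lt hr, add_zero]
      ring
    have hfilter : (Finset.range k).filter (fun i => i % Q = k % Q)
        = (Finset.range (k / Q)).image (fun m => Q * m + k % Q) := by
      ext i
      simp only [Finset.mem_filter, Finset.mem_image, Finset.mem_range]
      have hkd := Nat.div_add_mod k Q
      constructor
      · rintro ⟨h1, h2⟩
        have hid := Nat.div_add_mod i Q
        exact ⟨i / Q, Nat.lt_of_mul_lt_mul_left (a := Q) (by omega), by omega⟩
      · rintro ⟨m, hm, rfl⟩
        have := Nat.mul_lt_mul_of_pos_left hm (by omega : 0 < Q)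
        exact ⟨by omega, by rw [Nat.mul_add_mod, Nat.mod_mod]⟩
    refine ⟨v * ∏ i ∈ (Finset.range k).filter (fun i => ¬ i % Q = k % Q),
      (digitExpansion c u Q k - digitExpansion c u Q i), ?_, ?_⟩
    · rw [hu.dvd_mul, not_or]
      refine ⟨hv, fun h => ?_⟩
      obtain ⟨i, hi, hd⟩ := (hu.dvd_finsetProd_iff _).1 h
      refine (Finset.mem_filter.1 hi).2 (hinj _ (Nat.mod_lt _ (by omega)) _ hr ?_)
      rw [digitExpansion_eq u hQ hc k, digitExpansion_eq u hQ hc i] at hd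
      obtain ⟨w, hw⟩ := hd
      exact ⟨digitExpansion c u Q (k / Q) - digitExpansion c u Q (i / Q) - w, by
        linear_combination -hw⟩
    · rw [← Finset.prod_filter_mul_prod_filter_not _ (fun i => i % Q = k % Q), hfilter,
        Finset.prod_image (fun i _ j _ h => Nat.eq_of_mul_eq_mul_left (by omega : 0 < Q)
        (Nat.add_right_cancel h))]
      simp only [hterm, Finset.prod_mul_distrib, Finset.prod_const, Finset.card_range]
      rw [hprod, legendreSum_eq hQ hk, pow_add]
      ring

/-- A sequence listing the polynomials of degree less than `n` in the first `q ^ n` places, for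
each `n`, and which is a `P`-ordering in the sense of Bhargava. -/
theorem exists_primeOrdering {K : Type*} [Field K] [Fintype K] {P : K[X]} (hP : Irreducible P) :
    ∃ a : ℕ → K[X], Function.Injective a ∧
      (∀ n : ℕ, ∀ k < Fintype.card K ^ n, (a k).degree < n) ∧
      (∀ k x, P ^ legendreSum (Fintype.card K ^ P.natDegree) k ∣
        ∏ i ∈ Finset.range k, (x - a i)) ∧
      ∀ k, ∃ v, ¬ P ∣ v ∧ ∏ i ∈ Finset.range k, (a k - a i)
        = P ^ legendreSum (Fintype.card K ^ P.natDegree) k * v := by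
  obtain ⟨b, hb0, hbinj, hbdeg⟩ := exists_enumeration K
  have hd : 0 < P.natDegree := hP.natDegree_pos
  have hq : 1 < Fintype.card K := Fintype.one_lt_card
  have hQ : 1 < Fintype.card K ^ P.natDegree := Nat.one_lt_pow hd.ne' hq
  have hPdeg := degree_eq_natDegree hP.ne_zero
  have hinj : ∀ r < Fintype.card K ^ P.natDegree, ∀ s < Fintype.card K ^ P.natDegree,
      P ∣ b r - b s → r = s := by
    intro r hr s hs h
    refine hbinj (sub_eq_zero.1 (eq_zero_of_dvd_of_degree_lt h ?_))
    rw [hPdeg]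
    exact (degree_sub_le _ _).trans_lt (max_lt (hbdeg _ r hr) (hbdeg _ s hs))
  have hsurj : ∀ x, ∃ r < Fintype.card K ^ P.natDegree, P ∣ x - b r := by
    intro x
    obtain ⟨r, hr, h⟩ := exists_eq_of_degree_lt hbinj (hbdeg P.natDegree)
      (h := x % P) (hPdeg ▸ EuclideanDomain.mod_lt x hP.ne_zero)
    refine ⟨r, hr, x / P, ?_⟩
    rw [h]
    linear_combination -(EuclideanDomain.div_add_mod x P)
  exact ⟨digitExpansion b P (Fintype.card K ^ P.natDegree),
    digitExpansion_injective hP.ne_zero hQ hb0 hinj,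
    degree_digitExpansion_lt hq hd hb0 (fun r _ => hbdeg r),
    pow_legendreSum_dvd_prod hQ hb0 hsurj,
    prod_sub_digitExpansion_self hP.prime hQ hb0 hinj⟩

/-- Division with remainder in the Newton basis attached to a sequence. -/
theorem exists_newton_expansion {R : Type*} [CommRing R] (a : ℕ → R) (N : ℕ) (G : R[X]) :
    ∃ (c : ℕ → R) (H : R[X]), ∀ x, G.eval x
      = ∑ k ∈ Finset.range N, c k * ∏ i ∈ Finset.range k, (x - a i)
        + (∏ i ∈ Finset.range N, (x - a i)) * H.eval x := by
  induction N with
  | zero => exact ⟨0, G, by simp⟩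
  | succ N ih =>
    obtain ⟨c, H, h⟩ := ih
    obtain ⟨H', hH'⟩ : X - C (a N) ∣ H - C (H.eval (a N)) := by
      rw [dvd_iff_isRoot]
      simp
    have hH : ∀ x, H.eval x = (x - a N) * H'.eval x + H.eval (a N) := fun x => by
      have := congrArg (eval x) hH'
      simp only [eval_sub, eval_C, eval_mul, eval_X] at this
      linear_combination this
    refine ⟨Function.update c N (H.eval (a N)), H', fun x => ?_⟩
    rw [h x, Finset.sum_range_succ, Finset.prod_range_succ, Function.update_self, hH x,
      Finset.sum_congr rfl fun k hk => by
        rw [← Function.update_of_ne (Finset.mem_range.1 hk).ne (H.eval (a N)) c]]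
    ring

/-- Two linear maps with the same kernel have ranges of the same cardinality. -/
theorem natCard_range_eq_of_ker_eq {R M M₁ M₂ : Type*} [Ring R] [AddCommGroup M] [Module R M]
    [AddCommGroup M₁] [Module R M₁] [AddCommGroup M₂] [Module R M₂] (φ : M →ₗ[R] M₁)
    (ψ : M →ₗ[R] M₂) (h : LinearMap.ker φ = LinearMap.ker ψ) :
    Nat.card (LinearMap.range φ) = Nat.card (LinearMap.range ψ) :=
  Nat.card_congr (φ.quotKerEquivRange.symm.trans
    ((Submodule.quotEquivOfEq _ _ h).trans ψ.quotKerEquivRange)).toEquiv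

/-- A combination of Newton polynomials vanishes modulo `P ^ e` at the points of a `P`-ordering
exactly when each coefficient is divisible by the appropriate power of `P`. -/
theorem newton_combination_dvd_iff {R : Type*} [CommRing R] [IsDomain R] {P : R} (hP : Prime P)
    {a : ℕ → R} {w : ℕ → ℕ} (hdvd : ∀ k x, P ^ w k ∣ ∏ i ∈ Finset.range k, (x - a i))
    (hself : ∀ k, ∃ v, ¬ P ∣ v ∧ ∏ i ∈ Finset.range k, (a k - a i) = P ^ w k * v)
    (e : ℕ) {N : ℕ} (c : Fin N → R) :
    (∀ j : Fin N, P ^ e ∣ ∑ k : Fin N, c k * ∏ i ∈ Finset.range k, (a j - a i)) ↔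
      ∀ k : Fin N, P ^ (e - w k) ∣ c k := by
  have hterm : ∀ (k : Fin N) (x : R), P ^ (e - w k) ∣ c k →
      P ^ e ∣ c k * ∏ i ∈ Finset.range k, (x - a i) := fun k x hk =>
    (pow_dvd_pow P (by omega : e ≤ (e - w k) + w k)).trans
      (pow_add P _ _ ▸ mul_dvd_mul hk (hdvd k x))
  refine ⟨fun h k => ?_, fun h j => Finset.dvd_sum fun k _ => hterm k _ (h k)⟩
  obtain ⟨k, hk⟩ := k
  induction k using Nat.strong_induction_on with
  | _ k ih =>
    have hsum := h ⟨k, hk⟩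
    rw [← Finset.add_sum_erase _ _ (Finset.mem_univ ⟨k, hk⟩)] at hsum
    have hrest : P ^ e ∣ ∑ m ∈ Finset.univ.erase (⟨k, hk⟩ : Fin N),
        c m * ∏ i ∈ Finset.range m, (a k - a i) := by
      refine Finset.dvd_sum fun m hm => ?_
      rcases lt_or_gt_of_ne (fun h => (Finset.ne_of_mem_erase hm) (Fin.ext h) : (m : ℕ) ≠ k)
        with hlt | hgt
      · exact hterm m _ (ih m hlt m.2)
      · rw [Finset.prod_eq_zero (Finset.mem_range.2 hgt) (sub_self _), mul_zero]
        exact dvd_zero _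
    obtain ⟨v, hv, hprod⟩ := hself k
    have hk' := (dvd_add_left hrest).1 hsum
    simp only [hprod] at hk'
    rcases le_total e (w k) with hle | hle
    · simp [Nat.sub_eq_zero_of_le hle]
    · rw [mul_left_comm, ← Nat.add_sub_cancel' hle, pow_add,
        mul_dvd_mul_iff_left (pow_ne_zero _ hP.ne_zero)] at hk'
      exact hP.pow_dvd_of_dvd_mul_right _ hv hk'

theorem natCard_quotient_span_singleton {K : Type*} [Field K] [Fintype K] {g : K[X]}
    (hg : g.Monic) : Nat.card (K[X] ⧸ Ideal.span {g}) = Fintype.card K ^ g.natDegree := by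
  have : Module.Finite K (K[X] ⧸ Ideal.span {g}) := hg.finite_quotient
  rw [Module.natCard_eq_pow_finrank (K := K), finrank_quotient_span_eq_natDegree,
    Nat.card_eq_fintype_card]

theorem bijective_mk_of_enumeration {K : Type*} [Field K] [Fintype K] {a : ℕ → K[X]}
    (ha : Function.Injective a) {f : K[X]} (hf : f ≠ 0)
    (hdeg : ∀ k < Fintype.card K ^ f.natDegree, (a k).degree < f.natDegree) :
    Function.Bijective fun j : Fin (Fintype.card K ^ f.natDegree) =>
      Ideal.Quotient.mk (Ideal.span {f}) (a j) := by
  have hfd := degree_eq_natDegree hf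
  constructor
  · intro i j hij
    have h := Ideal.mem_span_singleton.1 (Ideal.Quotient.eq.1 hij)
    refine Fin.ext (ha (sub_eq_zero.1 (eq_zero_of_dvd_of_degree_lt h ?_)))
    rw [hfd]
    exact (degree_sub_le _ _).trans_lt (max_lt (hdeg i i.2) (hdeg j j.2))
  · intro y
    obtain ⟨x, rfl⟩ := Ideal.Quotient.mk_surjective y
    obtain ⟨k, hk, h⟩ := exists_eq_of_degree_lt ha hdeg
      (h := x % f) (hfd ▸ EuclideanDomain.mod_lt x hf)
    refine ⟨⟨k, hk⟩, Ideal.Quotient.eq.2 (Ideal.mem_span_singleton.2 ⟨-(x / f), ?_⟩)⟩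
    simp only [h]
    linear_combination EuclideanDomain.div_add_mod x f

/-- The coefficients with respect to the Newton basis of `a`, sent to the values at `a 0`, …,
`a (N - 1)` modulo `g`. -/
def newtonValues {R : Type*} [CommRing R] (a : ℕ → R) (N : ℕ) (g : R) :
    (Fin N → R) →ₗ[R] (Fin N → R ⧸ Ideal.span {g}) :=
  LinearMap.pi fun j => Algebra.linearMap R (R ⧸ Ideal.span {g}) ∘ₗ
    Fintype.linearCombination R fun k : Fin N => ∏ i ∈ Finset.range k, (a j - a i)

theorem newtonValues_apply {R : Type*} [CommRing R] (a : ℕ → R) (N : ℕ) (g : R) (c : Fin N → R)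
    (j : Fin N) : newtonValues a N g c j = Ideal.Quotient.mk (Ideal.span {g})
      (∑ k : Fin N, c k * ∏ i ∈ Finset.range k, (a j - a i)) := by
  simp [newtonValues, Fintype.linearCombination_apply]

theorem mem_range_newtonValues_iff {R : Type*} [CommRing R] (a : ℕ → R) (N : ℕ) (g : R)
    (τ : Fin N → R ⧸ Ideal.span {g}) :
    τ ∈ LinearMap.range (newtonValues a N g) ↔
      ∃ G : R[X], ∀ j : Fin N, τ j = Ideal.Quotient.mk (Ideal.span {g}) (G.eval (a j)) := by
  constructor
  · rintro ⟨c, rfl⟩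
    refine ⟨∑ k : Fin N, C (c k) * ∏ i ∈ Finset.range k, (X - C (a i)), fun j => ?_⟩
    simp only [newtonValues_apply, eval_finsetSum, eval_mul, eval_C, eval_prod, eval_sub, eval_X]
  · rintro ⟨G, hG⟩
    obtain ⟨c, H, h⟩ := exists_newton_expansion a N G
    refine ⟨fun k => c k, funext fun j => ?_⟩
    rw [newtonValues_apply, hG, h, Finset.prod_eq_zero (Finset.mem_range.2 j.2) (sub_self _),
      zero_mul, add_zero, Finset.sum_range]

theorem natCard_range_newtonValues {K : Type*} [Field K] [Fintype K] {P : K[X]}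
    (hPmonic : P.Monic) (hP : Prime P) {a : ℕ → K[X]} {w : ℕ → ℕ}
    (hdvd : ∀ k x, P ^ w k ∣ ∏ i ∈ Finset.range k, (x - a i))
    (hself : ∀ k, ∃ v, ¬ P ∣ v ∧ ∏ i ∈ Finset.range k, (a k - a i) = P ^ w k * v)
    (e N : ℕ) :
    Nat.card (LinearMap.range (newtonValues a N (P ^ e)))
      = Fintype.card K ^ (P.natDegree * ∑ k ∈ Finset.range N, (e - w k)) := by
  let ψ : (Fin N → K[X]) →ₗ[K[X]] ((k : Fin N) → K[X] ⧸ Ideal.span {P ^ (e - w k)}) :=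
    LinearMap.pi fun k => Algebra.linearMap K[X] (K[X] ⧸ Ideal.span {P ^ (e - w k)}) ∘ₗ
      LinearMap.proj k
  have hψ : ∀ c k, ψ c k = Ideal.Quotient.mk _ (c k) := fun c k => rfl
  have hψsurj : LinearMap.range ψ = ⊤ := by
    refine LinearMap.range_eq_top.2 fun y => ?_
    choose c hc using fun k => Ideal.Quotient.mk_surjective (y k)
    exact ⟨c, funext hc⟩
  rw [natCard_range_eq_of_ker_eq _ ψ, hψsurj, Nat.card_congr Submodule.topEquiv.toEquiv,
    Nat.card_pi]
  · simp only [natCard_quotient_span_singleton (hPmonic.pow _), natDegree_pow]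
    rw [Finset.prod_pow_eq_pow_sum, ← Finset.sum_mul, mul_comm, Finset.sum_range]
  · ext c
    simp only [LinearMap.mem_ker, funext_iff, newtonValues_apply, hψ, Pi.zero_apply,
      Ideal.Quotient.eq_zero_iff_mem, Ideal.mem_span_singleton]
    exact newton_combination_dvd_iff hP hdvd hself e c

/-- Restricting a function on `A_f` to an enumeration of the representatives identifies polynomial
functions with the value vectors of Newton combinations. -/
theorem natCard_isPolyFun {a : ℕ → F[X]} (ha : Function.Injective a) {f : F[X]} (hf : f ≠ 0)
    (hdeg : ∀ k < Fintype.card F ^ f.natDegree, (a k).degree < f.natDegree) (g : F[X]) :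
    Nat.card {σ : (F[X] ⧸ Ideal.span {f}) → F[X] ⧸ Ideal.span {g} // IsPolyFun f g σ}
      = Nat.card (LinearMap.range (newtonValues a (Fintype.card F ^ f.natDegree) g)) := by
  refine Nat.card_congr (Equiv.subtypeEquiv
    (Equiv.arrowCongr (Equiv.ofBijective _ (bijective_mk_of_enumeration ha hf hdeg)).symm
      (Equiv.refl _)) fun σ => ?_)
  rw [mem_range_newtonValues_iff]
  refine exists_congr fun G => ⟨fun h j => ?_, fun h x hx => ?_⟩
  · exact h _ (degree_eq_natDegree hf ▸ hdeg j j.2)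
  · rw [degree_eq_natDegree hf] at hx
    obtain ⟨k, hk, rfl⟩ := exists_eq_of_degree_lt ha hdeg hx
    exact h ⟨k, hk⟩

/-- Corollary: counting polynomial functions `A_f → A_{P^e}`.
With `n = deg f`, `d = deg P`, the number `N(f, P^e)` of polynomial functions satisfies
`N(f,P^e) · |P|^{Σ_{k=1}^{q^n-1} min{e, Σ_{j≥1} ⌊k/q^{dj}⌋}} = |P|^{e q^n}`,
i.e. `N(f,P^e) = |P|^{e q^n - Σ_{k=1}^{q^n-1} min{e, ⌊k/q^d⌋ + ⌊k/q^{2d}⌋ + ⋯}}`.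
(The inner sum `Σ_{j≥1} ⌊k/q^{dj}⌋` is written as `Σ_{j=1}^{k} ⌊k/q^{dj}⌋`; all further
terms vanish since `q^{dj} > k` for `j > k`.) -/
theorem countPolyFun_primePow (f P : Polynomial F) (hf : 1 ≤ f.natDegree)
    (hPmonic : P.Monic) (hPirr : Irreducible P) (e : ℕ) (he : 1 ≤ e) :
    Nat.card {σ : (Polynomial F ⧸ Ideal.span {f}) → Polynomial F ⧸ Ideal.span {P ^ e} //
        IsPolyFun f (P ^ e) σ} *
      (Fintype.card F) ^ (P.natDegree *
        ∑ k ∈ Finset.Ico 1 ((Fintype.card F) ^ f.natDegree),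
          min e (∑ j ∈ Finset.Icc 1 k, k / (Fintype.card F) ^ (P.natDegree * j)))
    = (Fintype.card F) ^ (P.natDegree * (e * (Fintype.card F) ^ f.natDegree)) := by
  obtain ⟨a, ha, hdeg, hdvd, hself⟩ := exists_primeOrdering hPirr
  rw [natCard_isPolyFun ha (ne_zero_of_natDegree_gt hf) (hdeg _),
    natCard_range_newtonValues hPmonic hPirr.prime hdvd hself, ← pow_add, ← mul_add]
  congr 2
  have hN : 0 < Fintype.card F ^ f.natDegree := pow_pos Fintype.card_pos _
  have hsum : ∑ k ∈ Finset.Ico 1 (Fintype.card F ^ f.natDegree),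
      min e (∑ j ∈ Finset.Icc 1 k, k / Fintype.card F ^ (P.natDegree * j))
      = ∑ k ∈ Finset.range (Fintype.card F ^ f.natDegree),
        min e (legendreSum (Fintype.card F ^ P.natDegree) k) := by
    rw [Finset.range_eq_Ico, Finset.sum_eq_sum_Ico_succ_bot hN]
    simp [legendreSum, pow_mul]
  rw [hsum, ← Finset.sum_add_distrib, Finset.sum_congr rfl fun k _ =>
    (by omega : e - legendreSum (Fintype.card F ^ P.natDegree) k
      + min e (legendreSum (Fintype.card F ^ P.natDegree) k) = e)]
  simp [mul_comm]
end
end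

section
/- Let f ∈ A be non-constant, P ∈ A monic irreducible, and e ≥ 1. Then (f, P^e) is a Chen pair if and only if deg f < γ(P^e), i.e., if and only if e = 1, or (q = 2, e = 2 and deg P = 1), or q^{deg f} ≤ 2 q^{deg P}. -/
open Polynomial

noncomputable section

variable {F : Type*} [Field F] [Fintype F]

/-- The function `γ` on prime powers `P^e` (`q` is the size of the base field):
if `q = 2`: `γ(P^e) = ∞` if `e = 1`, or if `e = 2` and `deg P = 1`, and `deg P + 2` otherwise;
if `q > 2`: `γ(P^e) = ∞` if `e = 1`, and `deg P + 1` otherwise. -/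
def gammaPow (q : ℕ) (P : Polynomial F) (e : ℕ) : ℕ∞ :=
  if e = 1 then ⊤
  else if q = 2 then (if e = 2 ∧ P.natDegree = 1 then ⊤ else ((P.natDegree + 2 : ℕ) : ℕ∞))
  else ((P.natDegree + 1 : ℕ) : ℕ∞)

section Interpolation

variable {R : Type*} [CommRing R] [IsPrincipalIdealRing R]

/-- A congruence preserving function on a finite set meeting every residue class modulo `p` in at
most two points is interpolated by a polynomial modulo `p ^ e`. -/
lemma exists_polynomial_dvd_sub_eval {p : R} (hp : Irreducible p) (e : ℕ) (s : R → R)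
    (S : Finset R)
    (hs : ∀ a ∈ S, ∀ b ∈ S, ∀ d, d ∣ p ^ e → d ∣ a - b → d ∣ s a - s b)
    (hS : ∀ a ∈ S, ∀ b ∈ S, ∀ c ∈ S, p ∣ a - b → p ∣ a - c → b = a ∨ c = a ∨ b = c) :
    ∃ G : R[X], ∀ a ∈ S, p ^ e ∣ s a - G.eval a := by
  classical
  induction S using Finset.induction_on with
  | empty => exact ⟨0, by simp⟩
  | insert a S ha ih =>
    obtain ⟨G, hG⟩ := ih
      (fun x hx y hy => hs x (Finset.mem_insert_of_mem hx) y (Finset.mem_insert_of_mem hy))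
      (fun x hx y hy z hz => hS x (Finset.mem_insert_of_mem hx) y (Finset.mem_insert_of_mem hy)
        z (Finset.mem_insert_of_mem hz))
    have haS := Finset.mem_insert_self a S
    have hcop : ∀ T : Finset R, (∀ b ∈ T, ¬ p ∣ a - b) →
        IsCoprime (p ^ e) (∏ b ∈ T, (a - b)) := fun T hT =>
      IsCoprime.pow_left (IsCoprime.prod_right fun b hb =>
        (hp.coprime_iff_not_dvd).2 (hT b hb))
    obtain ⟨w, hw⟩ : ∃ w, p ^ e ∣ s a - G.eval a - w * ∏ b ∈ S, (a - b) := by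
      by_cases h : ∃ j ∈ S, p ∣ a - j
      · obtain ⟨j, hj, hpj⟩ := h
        have hjS := Finset.mem_insert_of_mem (a := j) (b := a) hj
        obtain ⟨r, hr⟩ : ∃ r, p ^ e ∣ s a - G.eval a - (a - j) * r := by
          obtain ⟨x, y, hxy⟩ := IsBezout.gcd_eq_sum (p ^ e) (a - j)
          obtain ⟨k, hk⟩ := hs a haS j hjS _ (IsBezout.gcd_dvd_left (p ^ e) (a - j))
            (IsBezout.gcd_dvd_right (p ^ e) (a - j))
          obtain ⟨l, hl⟩ := sub_dvd_eval_sub a j G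
          obtain ⟨m, hm⟩ := hG j hj
          rw [← hxy] at hk
          exact ⟨y * k - l, x * k + m, by linear_combination hk - hl + hm⟩
        obtain ⟨u, v, huv⟩ := hcop (S.erase j) (by
          intro b hb hpb
          rcases hS a haS j hjS b (Finset.mem_insert_of_mem (Finset.mem_of_mem_erase hb))
            hpj hpb with h | h | h
          · exact ha (h ▸ hj)
          · exact ha (h ▸ Finset.mem_of_mem_erase hb)
          · exact Finset.ne_of_mem_erase hb h.symm)
        obtain ⟨k, hk⟩ := hr
        rw [← Finset.mul_prod_erase S _ hj]
        exact ⟨r * v, k + (a - j) * r * u, by linear_combination hk - (a - j) * r * huv⟩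
      · push Not at h
        obtain ⟨u, v, huv⟩ := hcop S h
        exact ⟨(s a - G.eval a) * v, (s a - G.eval a) * u, by
          linear_combination - (s a - G.eval a) * huv⟩
    refine ⟨G + C w * ∏ b ∈ S, (X - C b), fun x hx => ?_⟩
    simp only [eval_add, eval_mul, eval_C, eval_prod, eval_sub, eval_X]
    rcases Finset.mem_insert.1 hx with rfl | hx
    · rwa [← sub_sub]
    · rw [Finset.prod_eq_zero hx (sub_self x), mul_zero, add_zero]
      exact hG x hx

omit [IsPrincipalIdealRing R] in
lemma exists_eq_quadratic_add (G : R[X]) :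
    ∃ (a b c : R) (H : R[X]), G = C a + X * (C b + X * (C c + X * H)) := by
  refine ⟨G.coeff 0, G.divX.coeff 0, G.divX.divX.coeff 0, G.divX.divX.divX, ?_⟩
  conv_lhs => rw [← divX_mul_X_add G, ← divX_mul_X_add G.divX, ← divX_mul_X_add G.divX.divX]
  ring

end Interpolation

omit [Fintype F] in
lemma IsCongPres.exists_lift {f g : F[X]}
    {σ : (F[X] ⧸ Ideal.span {f}) → F[X] ⧸ Ideal.span {g}} (hσ : IsCongPres f g σ) :
    ∃ s : F[X] → F[X], (∀ h, Ideal.Quotient.mk (Ideal.span {g}) (s h) =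
        σ (Ideal.Quotient.mk (Ideal.span {f}) h)) ∧
      ∀ a b d : F[X], a.degree < f.degree → b.degree < f.degree →
        d ∣ g → d ∣ a - b → d ∣ s a - s b := by
  choose s hs using fun h : F[X] =>
    Ideal.Quotient.mk_surjective (σ (Ideal.Quotient.mk (Ideal.span {f}) h))
  exact ⟨s, hs, fun a b d ha hb hd hab => hσ a b d ha hb hd hab _ _ (hs a) (hs b)⟩

lemma finite_setOf_degree_lt (m : ℕ) : {h : F[X] | h.degree < m}.Finite := by
  have : Finite (degreeLT F m) := Finite.of_equiv _ (degreeLTEquiv F m).toEquiv.symm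
  have h : (degreeLT F m : Set F[X]).Finite := Set.toFinite _
  refine h.subset fun x hx => ?_
  exact mem_degreeLT.2 hx

/-- Residue classes modulo `P` have at most two representatives of degree less than `m`, provided
`m ≤ deg P`, or `q = 2` and `m ≤ deg P + 1`. -/
lemma eq_or_eq_or_eq_of_dvd_sub {P : F[X]} (hP : P ≠ 0) {m : ℕ}
    (hm : m ≤ P.natDegree ∨ (Fintype.card F = 2 ∧ m ≤ P.natDegree + 1))
    {a b c : F[X]} (ha : a.degree < m) (hb : b.degree < m) (hc : c.degree < m)
    (hab : P ∣ a - b) (hac : P ∣ a - c) : b = a ∨ c = a ∨ b = c := by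
  have key : ∀ x : F[X], x.degree < m → P ∣ a - x → x = a ∨ (Fintype.card F = 2 ∧ x = a - P) := by
    intro x hx hdvd
    by_cases hxa : x = a
    · exact Or.inl hxa
    have hne : a - x ≠ 0 := sub_ne_zero.2 (Ne.symm hxa)
    have hlt : (a - x).natDegree < m :=
      (natDegree_lt_iff_degree_lt hne).2 ((degree_sub_le _ _).trans_lt (max_lt ha hx))
    have hle := natDegree_le_of_dvd hdvd hne
    obtain ⟨u, hu⟩ := hdvd
    have hu0 : u ≠ 0 := by rintro rfl; simp [hne] at hu
    have hdeg := congrArg natDegree hu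
    rw [natDegree_mul hP hu0] at hdeg
    rcases hm with hm | ⟨hq, hm⟩
    · omega
    have hu' : u = C (u.coeff 0) := eq_C_of_natDegree_eq_zero (by omega)
    have hc0 : u.coeff 0 ≠ 0 := fun h => hu0 (by rw [hu', h, C_0])
    have h1 := FiniteField.pow_card_sub_one_eq_one _ hc0
    rw [hq, pow_one] at h1
    rw [h1, C_1] at hu'
    rw [hu', mul_one] at hu
    exact Or.inr ⟨hq, by rw [← hu]; ring⟩
  rcases key b hb hab with h | ⟨-, h⟩
  · exact Or.inl h
  rcases key c hc hac with h' | ⟨-, h'⟩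
  · exact Or.inr (Or.inl h')
  · exact Or.inr (Or.inr (h.trans h'.symm))

lemma isChenPair_of_le {f P : F[X]} (hf : f ≠ 0) (hP : Irreducible P) {e m : ℕ}
    (hmf : m ≤ f.natDegree) (hme : m = f.natDegree ∨ e * P.natDegree ≤ m)
    (hm : m ≤ P.natDegree ∨ (Fintype.card F = 2 ∧ m ≤ P.natDegree + 1)) :
    IsChenPair f (P ^ e) := by
  intro σ hσ
  obtain ⟨s, hs, hcong⟩ := hσ.exists_lift
  have hlt : ∀ {h : F[X]}, h.degree < m → h.degree < f.degree := fun hh => by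
    rw [degree_eq_natDegree hf]
    exact hh.trans_le (by exact_mod_cast hmf)
  have hmem : ∀ h : F[X], h ∈ (finite_setOf_degree_lt (F := F) m).toFinset ↔ h.degree < m := by
    simp
  obtain ⟨G, hG⟩ := exists_polynomial_dvd_sub_eval hP e s (finite_setOf_degree_lt m).toFinset
    (fun a ha b hb d hd hab => hcong a b d (hlt ((hmem a).1 ha)) (hlt ((hmem b).1 hb)) hd hab)
    (fun a ha b hb c hc => eq_or_eq_or_eq_of_dvd_sub hP.ne_zero hm
      ((hmem a).1 ha) ((hmem b).1 hb) ((hmem c).1 hc))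
  refine ⟨G, fun h hh => ?_⟩
  rw [← hs, Ideal.Quotient.mk_eq_mk_iff_sub_mem, Ideal.mem_span_singleton]
  rcases hme with rfl | hme
  · exact hG h ((hmem h).2 (by rwa [← degree_eq_natDegree hf]))
  have hPe : P ^ e ≠ 0 := pow_ne_zero _ hP.ne_zero
  have hr : (h % P ^ e).degree < m := by
    refine (EuclideanDomain.mod_lt h hPe : (h % P ^ e).degree < (P ^ e).degree).trans_le ?_
    rw [degree_eq_natDegree hPe, natDegree_pow]
    exact_mod_cast hme
  have hd : P ^ e ∣ h - h % P ^ e :=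
    ⟨h / P ^ e, by linear_combination - EuclideanDomain.div_add_mod h (P ^ e)⟩
  have h1 := hcong h _ _ hh (hlt hr) dvd_rfl hd
  have h2 := hG _ ((hmem _).2 hr)
  have h3 := hd.trans (sub_dvd_eval_sub h (h % P ^ e) G)
  convert dvd_sub (dvd_add h1 h2) h3 using 1
  ring

omit [Fintype F] in
/-- If every polynomial vanishing modulo `P ^ (k + 1)` off the residue class of `z` also vanishes
at `z`, then `P ^ k` times the indicator of that class is congruence preserving but not
polynomial. -/
lemma not_isChenPair_of_forall_dvd_eval {f P z : F[X]} (hP : Irreducible P) {e k : ℕ}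
    (hk : k + 1 ≤ e) (hz : z.degree < f.degree)
    (H : ∀ G : F[X][X], (∀ h : F[X], h.degree < f.degree → ¬ P ^ (k + 1) ∣ h - z →
      P ^ (k + 1) ∣ G.eval h) → P ^ (k + 1) ∣ G.eval z) :
    ¬ IsChenPair f (P ^ e) := by
  classical
  intro hchen
  let τ : F[X] → F[X] := fun h => if P ^ (k + 1) ∣ h - z then P ^ k else 0
  let σ : (F[X] ⧸ Ideal.span {f}) → F[X] ⧸ Ideal.span {P ^ e} := fun x =>
    Ideal.Quotient.mk _ (τ (Quotient.out x % f))
  have hσ : ∀ h : F[X], h.degree < f.degree →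
      σ (Ideal.Quotient.mk _ h) = Ideal.Quotient.mk _ (τ h) := by
    intro h hh
    have hf : f ≠ 0 := by rintro rfl; simp at hh
    have hout : Ideal.Quotient.mk (Ideal.span {f})
        (Quotient.out (Ideal.Quotient.mk (Ideal.span {f}) h)) = Ideal.Quotient.mk _ h :=
      Quotient.out_eq _
    rw [Ideal.Quotient.mk_eq_mk_iff_sub_mem, Ideal.mem_span_singleton,
      ← EuclideanDomain.mod_eq_zero, sub_mod, sub_eq_zero, (mod_eq_self_iff hf).2 hh] at hout
    simp only [σ, hout]
  have hτ : ∀ h₁ h₂ d : F[X], d ∣ P ^ e → d ∣ h₁ - h₂ → d ∣ τ h₁ - τ h₂ := by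
    intro h₁ h₂ d hd h12
    obtain ⟨i, -, hi⟩ := (dvd_prime_pow hP.prime e).1 hd
    by_cases hik : i ≤ k
    · have hdk : d ∣ P ^ k := hi.dvd.trans (pow_dvd_pow P hik)
      refine dvd_sub ?_ ?_ <;> simp only [τ] <;> split_ifs <;> simp [hdk]
    · have h12' : P ^ (k + 1) ∣ h₁ - h₂ :=
        ((pow_dvd_pow P (by omega)).trans hi.symm.dvd).trans h12
      have : P ^ (k + 1) ∣ h₁ - z ↔ P ^ (k + 1) ∣ h₂ - z := by
        rw [show h₁ - z = (h₁ - h₂) + (h₂ - z) by ring, dvd_add_right h12']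
      simp [τ, this]
  obtain ⟨G, hG⟩ := hchen σ (by
    intro h₁ h₂ d hh₁ hh₂ hd h12 s₁ s₂ hs₁ hs₂
    rw [hσ _ hh₁, Ideal.Quotient.mk_eq_mk_iff_sub_mem, Ideal.mem_span_singleton] at hs₁
    rw [hσ _ hh₂, Ideal.Quotient.mk_eq_mk_iff_sub_mem, Ideal.mem_span_singleton] at hs₂
    convert dvd_add (dvd_sub (hd.trans hs₁) (hd.trans hs₂)) (hτ h₁ h₂ d hd h12) using 1
    ring)
  have hG' : ∀ h : F[X], h.degree < f.degree → P ^ (k + 1) ∣ τ h - G.eval h := by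
    intro h hh
    have := hG h hh
    rw [hσ _ hh, Ideal.Quotient.mk_eq_mk_iff_sub_mem, Ideal.mem_span_singleton] at this
    exact (pow_dvd_pow P hk).trans this
  have hGz := H G (fun h hh hhz => by simpa [τ, hhz] using hG' h hh)
  have hz' := hG' z hz
  simp only [τ, sub_self, dvd_zero, if_true] at hz'
  have := (dvd_sub_left hGz).1 hz'
  rw [pow_dvd_pow_iff hP.ne_zero hP.not_isUnit] at this
  omega

omit [Fintype F] in
lemma not_isChenPair_of_exists_multiplier {f P u : F[X]} (hP : Irreducible P) {e : ℕ}
    (he : 2 ≤ e) (hu0 : ¬ P ∣ u) (hu1 : ¬ P ∣ 1 - u) (hdeg : (u * P).degree < f.degree) :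
    ¬ IsChenPair f (P ^ e) := by
  have hu : u ≠ 0 := by rintro rfl; simp at hu0
  have hPdeg : P.degree < f.degree :=
    (degree_le_of_dvd (dvd_mul_left P u) (mul_ne_zero hu hP.ne_zero)).trans_lt hdeg
  have h0deg : (0 : F[X]).degree < f.degree := by
    rw [degree_zero]; exact bot_le.trans_lt hdeg
  have hcancel : ∀ v : F[X], P ^ 2 ∣ P * v → P ∣ v := fun v hv => by
    rwa [pow_two, mul_dvd_mul_iff_left hP.ne_zero] at hv
  refine not_isChenPair_of_forall_dvd_eval hP (k := 1) he hdeg fun G hG => ?_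
  have h0 := hG 0 h0deg fun h => hu0 (hcancel u (by rwa [zero_sub, dvd_neg, mul_comm] at h))
  have h1 := hG P hPdeg fun h => hu1 (hcancel _ (by convert h using 1; ring))
  obtain ⟨a, b, c, H, rfl⟩ := exists_eq_quadratic_add G
  obtain ⟨k, hk⟩ := h0
  obtain ⟨l, hl⟩ := h1
  simp only [eval_add, eval_mul, eval_C, eval_X] at hk hl ⊢
  refine ⟨(1 - u) * k + u * l - u * (c + P * H.eval P) + u ^ 2 * (c + u * P * H.eval (u * P)), ?_⟩
  linear_combination (1 - u) * hk + u * hl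

omit [Fintype F] in
lemma not_isChenPair_of_three_le {f P : F[X]} (hP : Irreducible P) {e : ℕ}
    (he : 3 ≤ e) (hdeg : 2 * P.natDegree < f.natDegree) :
    ¬ IsChenPair f (P ^ e) := by
  have hf : f ≠ 0 := by rintro rfl; simp at hdeg
  have hlt : ∀ {h : F[X]}, h.natDegree ≤ 2 * P.natDegree → h.degree < f.degree := fun hh => by
    rw [degree_eq_natDegree hf]
    exact degree_le_natDegree.trans_lt (by exact_mod_cast hh.trans_lt hdeg)
  have hsq : (P ^ 2).natDegree ≤ 2 * P.natDegree := natDegree_pow_le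
  have hP1 : ¬ P ∣ 1 := fun h => hP.not_isUnit (isUnit_of_dvd_one h)
  have hP0 := hP.ne_zero
  refine not_isChenPair_of_forall_dvd_eval (z := P + P ^ 2) hP (k := 2) he
    (hlt ((natDegree_add_le _ _).trans (max_le (by omega) hsq))) fun G hG => ?_
  have h0 := hG 0 (hlt (by simp)) (by
    rintro ⟨v, hv⟩
    refine hP1 ⟨- P * v - 1, mul_left_cancel₀ hP0 ?_⟩
    linear_combination -hv)
  have h1 := hG P (hlt (by omega)) (by
    rintro ⟨v, hv⟩
    refine hP1 ⟨- v, mul_left_cancel₀ (pow_ne_zero 2 hP0) ?_⟩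
    linear_combination -hv)
  have h2 := hG (P ^ 2) (hlt hsq) (by
    rintro ⟨v, hv⟩
    refine hP1 ⟨- P * v, mul_left_cancel₀ hP0 ?_⟩
    linear_combination -hv)
  obtain ⟨a, b, c, H, rfl⟩ := exists_eq_quadratic_add G
  obtain ⟨k, hk⟩ := h0
  obtain ⟨l, hl⟩ := h1
  obtain ⟨m, hm⟩ := h2
  simp only [eval_add, eval_mul, eval_C, eval_X] at hk hl hm ⊢
  refine ⟨l + m - k + 2 * c - H.eval P - P ^ 3 * H.eval (P ^ 2) +
    (1 + P) ^ 3 * H.eval (P + P ^ 2), ?_⟩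
  linear_combination hl + hm - hk

lemma isChenPair_pow_iff (f P : F[X]) (hf : 1 ≤ f.natDegree) (hP : Irreducible P) (e : ℕ)
    (he : 1 ≤ e) :
    IsChenPair f (P ^ e) ↔
      (e = 1 ∨ (Fintype.card F = 2 ∧ e = 2 ∧ P.natDegree = 1) ∨ f.natDegree ≤ P.natDegree ∨
        (Fintype.card F = 2 ∧ f.natDegree ≤ P.natDegree + 1)) := by
  have hf0 : f ≠ 0 := by rintro rfl; simp at hf
  have hd : 0 < P.natDegree := hP.natDegree_pos
  have hq : 1 < Fintype.card F := Fintype.one_lt_card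
  constructor
  · contrapose!
    rintro ⟨he1, h2, hfP, hfP2⟩
    have he2 : 2 ≤ e := by omega
    by_cases hB : Fintype.card F = 2 ∧ P.natDegree = 1
    · have := hfP2 hB.1
      have := h2 hB.1
      exact not_isChenPair_of_three_le hP (by omega) (by omega)
    obtain ⟨u, hu0, hu1, hu, huf⟩ : ∃ u : F[X], u ≠ 0 ∧ u ≠ 1 ∧ u.natDegree < P.natDegree ∧
        u.natDegree + P.natDegree < f.natDegree := by
      by_cases hq2 : Fintype.card F = 2
      · have := hfP2 hq2
        exact ⟨X, X_ne_zero, fun h => by simpa using congrArg natDegree h,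
          by rw [natDegree_X]; omega, by rw [natDegree_X]; omega⟩
      · classical
        obtain ⟨c, -, hc⟩ := Finset.exists_mem_notMem_of_card_lt_card
          (s := ({0, 1} : Finset F)) (t := Finset.univ)
          (Finset.card_le_two.trans_lt (by rw [Finset.card_univ]; omega))
        simp only [Finset.mem_insert, Finset.mem_singleton, not_or] at hc
        exact ⟨C c, C_ne_zero.2 hc.1, fun h => hc.2 (C_injective (h.trans C_1.symm)),
          by simpa using hd, by simpa using hfP⟩
    have hndvd : ∀ v : F[X], v ≠ 0 → v.natDegree < P.natDegree → ¬ P ∣ v := fun v hv hlt hdvd =>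
      (natDegree_le_of_dvd hdvd hv).not_gt hlt
    refine not_isChenPair_of_exists_multiplier hP he2 (hndvd u hu0 hu)
      (hndvd _ (sub_ne_zero.2 hu1.symm)
        ((natDegree_sub_le _ _).trans_lt (max_lt (by simpa using hd) hu))) ?_
    rw [degree_eq_natDegree hf0, degree_eq_natDegree (mul_ne_zero hu0 hP.ne_zero),
      natDegree_mul hu0 hP.ne_zero]
    exact_mod_cast huf
  · rintro (rfl | ⟨hq2, rfl, hd1⟩ | h | h)
    · exact isChenPair_of_le hf0 hP (m := min f.natDegree P.natDegree) (by omega) (by omega)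
        (by omega)
    · exact isChenPair_of_le hf0 hP (m := min f.natDegree 2) (by omega) (by omega)
        (by omega)
    · exact isChenPair_of_le hf0 hP le_rfl (Or.inl rfl) (Or.inl h)
    · exact isChenPair_of_le hf0 hP le_rfl (Or.inl rfl) (Or.inr h)

lemma pow_le_two_mul_pow_iff {q n d : ℕ} (hq : 1 < q) :
    q ^ n ≤ 2 * q ^ d ↔ n ≤ d ∨ (q = 2 ∧ n ≤ d + 1) := by
  constructor
  · intro h
    by_contra! hcon
    obtain ⟨h1, h2⟩ := hcon
    by_cases hq2 : q = 2
    · subst hq2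
      rw [← pow_succ', Nat.pow_le_pow_iff_right hq] at h
      exact absurd (h2 rfl) (by omega)
    · have h3 : q ^ (d + 1) ≤ q ^ n := Nat.pow_le_pow_right (by omega) h1
      rw [pow_succ'] at h3
      have := Nat.le_of_mul_le_mul_right (h3.trans h) (by positivity)
      omega
  · rintro (h | ⟨rfl, h⟩)
    · have := Nat.pow_le_pow_right (n := q) (by omega) h
      omega
    · rw [← pow_succ']
      exact Nat.pow_le_pow_right (by omega) h

/-- Lemma: Chen pairs with prime power modulus.
`(f, P^e)` is a Chen pair iff `deg f < γ(P^e)`, i.e. iff `e = 1`, or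
`q = 2, e = 2, deg P = 1`, or `q^{deg f} ≤ 2 q^{deg P}`. -/
theorem chenPair_primePow_iff (f P : Polynomial F) (hf : 1 ≤ f.natDegree)
    (hPmonic : P.Monic) (hPirr : Irreducible P) (e : ℕ) (he : 1 ≤ e) :
    (IsChenPair f (P ^ e) ↔ (f.natDegree : ℕ∞) < gammaPow (Fintype.card F) P e) ∧
    (IsChenPair f (P ^ e) ↔
      (e = 1 ∨ (Fintype.card F = 2 ∧ e = 2 ∧ P.natDegree = 1) ∨
        (Fintype.card F) ^ f.natDegree ≤ 2 * (Fintype.card F) ^ P.natDegree)) := by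
  rw [isChenPair_pow_iff f P hf hPirr e he,
    pow_le_two_mul_pow_iff (Fintype.one_lt_card (α := F))]
  refine ⟨?_, Iff.rfl⟩
  unfold gammaPow
  split_ifs with h1 h2 h3
  · simp [h1]
  · simp [h2, h3]
  · rw [Nat.cast_lt]
    omega
  · rw [Nat.cast_lt]
    omega
end
end

section
/- Let q = 2 and A = F₂[t] (write x for the variable). For n ∈ ℕ let T(n) be the number of polynomials g ∈ A of degree n such that x³ ∤ g, (x+1)³ ∤ g, and P² ∤ g for every irreducible P with deg P ≥ 2. Then T(0) = 1, T(1) = 2, T(2) = 4, T(3) = 6, and T(n) = (1/9)(2^{n−3}·49 + (−1)^{n−1}(3n − 13)) for n ≥ 4. -/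
open Polynomial

theorem ZMod.eq_one_of_ne_zero_two {a : ZMod 2} (ha : a ≠ 0) : a = 1 := by
  revert a; decide

namespace Polynomial

theorem monic_of_ne_zero_zmod_two {g : (ZMod 2)[X]} (hg : g ≠ 0) : g.Monic :=
  ZMod.eq_one_of_ne_zero_two (leadingCoeff_ne_zero.mpr hg)

theorem eq_of_associated_zmod_two {f g : (ZMod 2)[X]} (hf : f ≠ 0) (h : Associated f g) : f = g :=
  eq_of_monic_of_associated (monic_of_ne_zero_zmod_two hf)
    (monic_of_ne_zero_zmod_two (h.ne_zero_iff.mp hf)) h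

theorem eq_X_or_eq_X_add_one {g : (ZMod 2)[X]} (hg : g.natDegree = 1) : g = X ∨ g = X + 1 := by
  have hm : g.Monic := monic_of_ne_zero_zmod_two (by rintro rfl; simp at hg)
  rw [hm.eq_X_add_C hg]
  by_cases h : g.coeff 0 = 0
  · left; simp [h]
  · right; simp [ZMod.eq_one_of_ne_zero_two h]

theorem ncard_degree_lt_zmod_two (n : ℕ) :
    {g : (ZMod 2)[X] | g.degree < n}.ncard = 2 ^ n := by
  have h := Nat.card_congr (degreeLTEquiv (ZMod 2) n).toEquiv
  simp only [Nat.card_eq_fintype_card (α := Fin n → ZMod 2), Fintype.card_fun, ZMod.card,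
    Fintype.card_fin] at h
  rw [← h, ← Nat.card_coe_set_eq]
  exact Nat.card_congr (Equiv.subtypeEquivRight fun g => mem_degreeLT.symm)

theorem finite_degree_lt_zmod_two (n : ℕ) : {g : (ZMod 2)[X] | g.degree < n}.Finite :=
  Set.finite_of_ncard_ne_zero (by rw [ncard_degree_lt_zmod_two]; positivity)

theorem finite_degree_eq_zmod_two (n : ℕ) : {g : (ZMod 2)[X] | g.degree = n}.Finite :=
  (finite_degree_lt_zmod_two (n + 1)).subset fun g hg => by
    simp only [Set.mem_ofPred_eq] at hg ⊢
    rw [hg]; exact_mod_cast n.lt_succ_self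

theorem ncard_degree_eq_zmod_two (n : ℕ) :
    {g : (ZMod 2)[X] | g.degree = n}.ncard = 2 ^ n := by
  have h : {g : (ZMod 2)[X] | g.degree < (n + 1 : ℕ)} =
      {g : (ZMod 2)[X] | g.degree < n} ∪ {g : (ZMod 2)[X] | g.degree = n} := by
    ext g
    simp only [Set.mem_ofPred_eq, Set.mem_union, ← le_iff_lt_or_eq]
    by_cases hg : g = 0
    · simp [hg]
    · rw [degree_eq_natDegree hg]
      norm_cast
      exact Nat.lt_succ_iff
  have hd : Disjoint {g : (ZMod 2)[X] | g.degree < n} {g | g.degree = n} :=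
    Set.disjoint_left.mpr fun g h₁ h₂ => h₁.ne h₂
  have hc := Set.ncard_union_eq hd (finite_degree_lt_zmod_two n) (finite_degree_eq_zmod_two n)
  rw [← h, ncard_degree_lt_zmod_two, ncard_degree_lt_zmod_two, pow_succ] at hc
  lia

/-- The number of polynomials of degree `n` over the field with two elements satisfying `p`. -/
noncomputable def countDegree (p : (ZMod 2)[X] → Prop) (n : ℕ) : ℕ :=
  {g : (ZMod 2)[X] | g.degree = n ∧ p g}.ncard

theorem finite_degree_eq_and (p : (ZMod 2)[X] → Prop) (n : ℕ) :
    {g : (ZMod 2)[X] | g.degree = n ∧ p g}.Finite :=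
  (finite_degree_eq_zmod_two n).subset fun _ hg => hg.1

theorem countDegree_congr {p q : (ZMod 2)[X] → Prop} (h : ∀ g, g ≠ 0 → (p g ↔ q g)) :
    countDegree p = countDegree q := by
  funext n
  unfold countDegree
  congr 1
  ext g
  simp only [Set.mem_ofPred_eq, and_congr_right_iff]
  intro hg
  exact h g (by rintro rfl; simp at hg)

theorem countDegree_zero_of_dvd {p : (ZMod 2)[X] → Prop} {l : (ZMod 2)[X]} (hl : l.degree = 1) :
    countDegree p 0 = countDegree (fun g => p g ∧ ¬ l ∣ g) 0 := by
  unfold countDegree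
  congr 1
  ext g
  simp only [Set.mem_ofPred_eq, and_congr_right_iff]
  intro hg
  refine (and_iff_left fun hd => ?_).symm
  have := degree_le_of_dvd hd (by rintro rfl; simp at hg)
  rw [hg, hl] at this
  exact absurd this (by decide)

/-- Sorting by divisibility by a linear polynomial `l`. -/
theorem countDegree_succ {p : (ZMod 2)[X] → Prop} {l : (ZMod 2)[X]} (hl : l.degree = 1) (n : ℕ) :
    countDegree p (n + 1) = countDegree (fun g => p g ∧ ¬ l ∣ g) (n + 1) +
      countDegree (fun g => p (l * g)) n := by
  have hl0 : l ≠ 0 := by rintro rfl; simp at hl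
  have h : {g : (ZMod 2)[X] | g.degree = (n + 1 : ℕ) ∧ p g} =
      {g : (ZMod 2)[X] | g.degree = (n + 1 : ℕ) ∧ p g ∧ ¬ l ∣ g} ∪
        (l * ·) '' {g : (ZMod 2)[X] | g.degree = n ∧ p (l * g)} := by
    ext g
    simp only [Set.mem_ofPred_eq, Set.mem_union, Set.mem_image]
    constructor
    · rintro ⟨hg, hp⟩
      by_cases hd : l ∣ g
      · obtain ⟨h, rfl⟩ := hd
        refine Or.inr ⟨h, ⟨?_, hp⟩, rfl⟩
        have h0 : h ≠ 0 := by rintro rfl; rw [mul_zero, degree_zero] at hg; exact WithBot.bot_ne_coe hg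
        rw [degree_mul, hl, degree_eq_natDegree h0] at hg
        rw [degree_eq_natDegree h0]
        norm_cast at hg ⊢
        lia
      · exact Or.inl ⟨hg, hp, hd⟩
    · rintro (⟨hg, hp, -⟩ | ⟨h, ⟨hg, hp⟩, rfl⟩)
      · exact ⟨hg, hp⟩
      · refine ⟨?_, hp⟩
        rw [degree_mul, hl, hg]
        norm_cast
        lia
  have hd : Disjoint {g : (ZMod 2)[X] | g.degree = (n + 1 : ℕ) ∧ p g ∧ ¬ l ∣ g}
      ((l * ·) '' {g : (ZMod 2)[X] | g.degree = n ∧ p (l * g)}) := by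
    rw [Set.disjoint_left]
    rintro _ ⟨-, -, hg⟩ ⟨h, -, rfl⟩
    exact hg (dvd_mul_right l h)
  unfold countDegree
  rw [h, Set.ncard_union_eq hd (finite_degree_eq_and _ _) ((finite_degree_eq_and _ _).image _),
    Set.ncard_image_of_injective _ (mul_right_injective₀ hl0)]

theorem exists_sq_mul_squarefree_zmod_two {g : (ZMod 2)[X]} (hg : g ≠ 0) :
    ∃ b a, Squarefree a ∧ b ^ 2 * a = g := by
  induction hn : g.natDegree using Nat.strong_induction_on generalizing g with
  | _ n ih =>
    by_cases hs : Squarefree g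
    · exact ⟨1, g, hs, by simp⟩
    · simp only [Squarefree, not_forall] at hs
      obtain ⟨c, ⟨h, rfl⟩, hc⟩ := hs
      have hc0 : c ≠ 0 := by rintro rfl; simp at hg
      have hh0 : h ≠ 0 := by rintro rfl; simp at hg
      have hcd : 0 < c.natDegree := natDegree_pos_iff_degree_pos.mpr
        (degree_pos_of_ne_zero_of_nonunit hc0 hc)
      rw [natDegree_mul (mul_ne_zero hc0 hc0) hh0, natDegree_mul hc0 hc0] at hn
      obtain ⟨b, a, ha, rfl⟩ := ih h.natDegree (by lia) hh0 rfl
      exact ⟨c * b, a, ha, by ring⟩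

end Polynomial

theorem dvd_of_sq_mul_dvd_sq_mul_squarefree {R : Type*} [CommRing R] [IsDomain R]
    [UniqueFactorizationMonoid R] {a b c d : R} (hc : Squarefree c) (hb : b ≠ 0)
    (h : b ^ 2 * a = d ^ 2 * c) : b ∣ d := by
  obtain ⟨b', d', e, hr, rfl, rfl⟩ := UniqueFactorizationMonoid.exists_reduced_factors b hb d
  have he : e ^ 2 ≠ 0 := pow_ne_zero 2 (left_ne_zero_of_mul hb)
  have h' : b' ^ 2 * a = d' ^ 2 * c := mul_left_cancel₀ he (by linear_combination h)
  have hdvd : b' ^ 2 ∣ c := (hr.pow (m := 2) (n := 2)).dvd_of_dvd_mul_left ⟨a, h'.symm⟩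
  have hu : IsUnit b' := hc b' (by rwa [← sq])
  exact mul_dvd_mul_left e hu.dvd

namespace Polynomial

theorem sum_countDegree_squarefree (n : ℕ) :
    ∑ k ∈ Finset.range (n / 2 + 1), 2 ^ k * countDegree Squarefree (n - 2 * k) = 2 ^ n := by
  set D : ℕ → Finset (ZMod 2)[X] := fun k => (finite_degree_eq_zmod_two k).toFinset with hD
  set S : ℕ → Finset (ZMod 2)[X] := fun k => (finite_degree_eq_and Squarefree k).toFinset with hS
  have hDc (k : ℕ) : (D k).card = 2 ^ k := by
    rw [← ncard_degree_eq_zmod_two, Set.ncard_eq_toFinset_card _ (finite_degree_eq_zmod_two k)]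
  have hSc (k : ℕ) : (S k).card = countDegree Squarefree k := by
    rw [countDegree, Set.ncard_eq_toFinset_card _ (finite_degree_eq_and Squarefree k)]
  have hDm {k : ℕ} {g : (ZMod 2)[X]} : g ∈ D k ↔ g ≠ 0 ∧ g.natDegree = k := by
    simp only [hD, Set.Finite.mem_toFinset, Set.mem_ofPred_eq]
    constructor
    · intro h
      exact ⟨by rintro rfl; simp at h, natDegree_eq_of_degree_eq_some h⟩
    · rintro ⟨h0, rfl⟩
      exact degree_eq_natDegree h0
  have hSm {k : ℕ} {g : (ZMod 2)[X]} : g ∈ S k ↔ g ∈ D k ∧ Squarefree g := by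
    simp [hD, hS]
  simp_rw [← hSc, ← hDc, ← Finset.card_product]
  rw [← Finset.card_sigma]
  refine Finset.card_bij (fun x _ => x.2.1 ^ 2 * x.2.2) ?_ ?_ ?_
  · rintro ⟨k, b, a⟩ h
    simp only [Finset.mem_sigma, Finset.mem_range, Finset.mem_product, hSm, hDm] at h ⊢
    obtain ⟨hk, ⟨hb, hbk⟩, ⟨ha, hak⟩, -⟩ := h
    refine ⟨mul_ne_zero (pow_ne_zero 2 hb) ha, ?_⟩
    rw [natDegree_mul (pow_ne_zero 2 hb) ha, natDegree_pow]
    lia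
  · rintro ⟨k, b, a⟩ h ⟨k', b', a'⟩ h' heq
    simp only [Finset.mem_sigma, Finset.mem_range, Finset.mem_product, hSm, hDm] at h h' heq
    obtain ⟨hk, ⟨hb, rfl⟩, ⟨ha, hak⟩, has⟩ := h
    obtain ⟨hk', ⟨hb', rfl⟩, ⟨ha', hak'⟩, has'⟩ := h'
    obtain rfl : b = b' := eq_of_associated_zmod_two hb (associated_of_dvd_dvd
      (dvd_of_sq_mul_dvd_sq_mul_squarefree has' hb heq)
      (dvd_of_sq_mul_dvd_sq_mul_squarefree has hb' heq.symm))
    obtain rfl : a = a' := mul_left_cancel₀ (pow_ne_zero 2 hb) heq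
    rfl
  · intro g hg
    rw [hDm] at hg
    obtain ⟨hg0, hgn⟩ := hg
    obtain ⟨b, a, ha, rfl⟩ := exists_sq_mul_squarefree_zmod_two hg0
    have hb0 : b ≠ 0 := by rintro rfl; simp at hg0
    have ha0 : a ≠ 0 := by rintro rfl; simp at hg0
    rw [natDegree_mul (pow_ne_zero 2 hb0) ha0, natDegree_pow] at hgn
    refine ⟨⟨b.natDegree, b, a⟩, ?_, rfl⟩
    simp only [Finset.mem_sigma, Finset.mem_range, Finset.mem_product, hSm, hDm]
    exact ⟨by lia, ⟨hb0, trivial⟩, ⟨ha0, by lia⟩, ha⟩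

theorem countDegree_squarefree_add_two (n : ℕ) :
    countDegree Squarefree (n + 2) = 2 ^ (n + 1) := by
  have h := sum_countDegree_squarefree (n + 2)
  rw [show (n + 2) / 2 + 1 = n / 2 + 1 + 1 by lia, Finset.sum_range_succ'] at h
  have h' : ∑ k ∈ Finset.range (n / 2 + 1),
      2 ^ (k + 1) * countDegree Squarefree (n + 2 - 2 * (k + 1)) = 2 * 2 ^ n := by
    rw [← sum_countDegree_squarefree n, Finset.mul_sum]
    refine Finset.sum_congr rfl fun k _ => ?_
    rw [show n + 2 - 2 * (k + 1) = n - 2 * k by lia]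
    ring
  rw [h'] at h
  simp only [pow_zero, one_mul, mul_zero, Nat.sub_zero] at h
  rw [pow_add] at h ⊢
  lia

/-- `X ^ i ∤ g`, `(X + 1) ^ j ∤ g`, and no square of an irreducible polynomial of degree at least
two divides `g`. -/
def AlmostSquarefree (i j : ℕ) (g : (ZMod 2)[X]) : Prop :=
  ¬ X ^ i ∣ g ∧ ¬ (X + 1) ^ j ∣ g ∧ ∀ P : (ZMod 2)[X], Irreducible P → 2 ≤ P.natDegree → ¬ P ^ 2 ∣ g

theorem degree_X_add_one : (X + 1 : (ZMod 2)[X]).degree = 1 := degree_X_add_C 1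

theorem irreducible_X_add_one : Irreducible (X + 1 : (ZMod 2)[X]) :=
  irreducible_of_degree_eq_one degree_X_add_one

theorem isCoprime_X_X_add_one : IsCoprime (X : (ZMod 2)[X]) (X + 1) := ⟨-1, 1, by ring⟩

theorem sq_dvd_linear_mul_iff {P l g : (ZMod 2)[X]} (hP : Irreducible P) (hPd : 2 ≤ P.natDegree)
    (hl : l.degree = 1) : P ^ 2 ∣ l * g ↔ P ^ 2 ∣ g := by
  refine ⟨fun h => ?_, fun h => h.mul_left l⟩
  refine IsCoprime.dvd_of_dvd_mul_left (IsCoprime.pow_left ?_) h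
  refine (hP.coprime_iff_not_dvd).mpr fun hd => ?_
  have := natDegree_le_of_dvd hd (by rintro rfl; simp at hl)
  rw [natDegree_eq_of_degree_eq_some (n := 1) hl] at this
  lia

theorem almostSquarefree_X_mul (i j : ℕ) (g : (ZMod 2)[X]) :
    AlmostSquarefree (i + 1) j (X * g) ↔ AlmostSquarefree i j g := by
  have h : (X + 1 : (ZMod 2)[X]) ^ j ∣ X * g ↔ (X + 1) ^ j ∣ g :=
    ⟨isCoprime_X_X_add_one.symm.pow_left.dvd_of_dvd_mul_left, fun h => h.mul_left X⟩
  unfold AlmostSquarefree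
  rw [pow_succ', mul_dvd_mul_iff_left X_ne_zero, h]
  refine and_congr_right fun _ => and_congr_right fun _ => forall_congr' fun P =>
    forall_congr' fun hP => forall_congr' fun hd => ?_
  rw [sq_dvd_linear_mul_iff hP hd degree_X]

theorem almostSquarefree_X_add_one_mul (i j : ℕ) (g : (ZMod 2)[X]) :
    AlmostSquarefree i (j + 1) ((X + 1) * g) ↔ AlmostSquarefree i j g := by
  have h : (X : (ZMod 2)[X]) ^ i ∣ (X + 1) * g ↔ X ^ i ∣ g :=
    ⟨isCoprime_X_X_add_one.pow_left.dvd_of_dvd_mul_left, fun h => h.mul_left _⟩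
  unfold AlmostSquarefree
  rw [pow_succ', mul_dvd_mul_iff_left irreducible_X_add_one.ne_zero, h]
  refine and_congr_right fun _ => and_congr_right fun _ => forall_congr' fun P =>
    forall_congr' fun hP => forall_congr' fun hd => ?_
  rw [sq_dvd_linear_mul_iff hP hd degree_X_add_one]

theorem almostSquarefree_and_not_X_dvd (i j : ℕ) (g : (ZMod 2)[X]) :
    AlmostSquarefree (i + 1) j g ∧ ¬ X ∣ g ↔ AlmostSquarefree 1 j g := by
  have h : ¬ X ∣ g → ¬ X ^ (i + 1) ∣ g := mt (dvd_trans (dvd_pow_self X i.succ_ne_zero))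
  unfold AlmostSquarefree
  rw [pow_one]
  tauto

theorem almostSquarefree_and_not_X_add_one_dvd (i j : ℕ) (g : (ZMod 2)[X]) :
    AlmostSquarefree i (j + 1) g ∧ ¬ (X + 1) ∣ g ↔ AlmostSquarefree i 1 g := by
  have h : ¬ (X + 1) ∣ g → ¬ (X + 1) ^ (j + 1) ∣ g :=
    mt (dvd_trans (dvd_pow_self _ j.succ_ne_zero))
  unfold AlmostSquarefree
  rw [pow_one]
  tauto

theorem almostSquarefree_two_two {g : (ZMod 2)[X]} (hg : g ≠ 0) :
    AlmostSquarefree 2 2 g ↔ Squarefree g := by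
  rw [squarefree_iff_irreducible_sq_not_dvd_of_ne_zero hg]
  constructor
  · rintro ⟨h₁, h₂, h₃⟩ P hP
    rw [← sq]
    rcases Nat.lt_or_ge P.natDegree 2 with hd | hd
    · have hd1 : P.natDegree = 1 := by have := hP.natDegree_pos; lia
      rcases eq_X_or_eq_X_add_one hd1 with rfl | rfl <;> assumption
    · exact h₃ P hP hd
  · intro h
    simp only [← sq] at h
    exact ⟨h X irreducible_X, h _ irreducible_X_add_one, fun P hP _ => h P hP⟩

/-- The number of polynomials of degree `n` satisfying `AlmostSquarefree i j`. -/
noncomputable def countAlmostSquarefree (i j n : ℕ) : ℕ := countDegree (AlmostSquarefree i j) n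

theorem countAlmostSquarefree_succ_left (i j n : ℕ) :
    countAlmostSquarefree (i + 1) j (n + 1) =
      countAlmostSquarefree 1 j (n + 1) + countAlmostSquarefree i j n := by
  simp only [countAlmostSquarefree, countDegree_succ degree_X n (p := AlmostSquarefree (i + 1) j),
    almostSquarefree_and_not_X_dvd, almostSquarefree_X_mul]

theorem countAlmostSquarefree_succ_right (i j n : ℕ) :
    countAlmostSquarefree i (j + 1) (n + 1) =
      countAlmostSquarefree i 1 (n + 1) + countAlmostSquarefree i j n := by
  simp only [countAlmostSquarefree,
    countDegree_succ degree_X_add_one n (p := AlmostSquarefree i (j + 1)),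
    almostSquarefree_and_not_X_add_one_dvd, almostSquarefree_X_add_one_mul]

theorem countAlmostSquarefree_degree_zero (i j : ℕ) :
    countAlmostSquarefree (i + 1) (j + 1) 0 = countAlmostSquarefree 1 1 0 := by
  simp only [countAlmostSquarefree, countDegree_zero_of_dvd degree_X
    (p := AlmostSquarefree (i + 1) (j + 1)), almostSquarefree_and_not_X_dvd]
  rw [show (fun g => AlmostSquarefree 1 (j + 1) g) = AlmostSquarefree 1 (j + 1) from rfl,
    countDegree_zero_of_dvd degree_X_add_one]
  simp only [almostSquarefree_and_not_X_add_one_dvd]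

theorem countAlmostSquarefree_two_two (n : ℕ) :
    countAlmostSquarefree 2 2 n = countDegree Squarefree n := by
  rw [countAlmostSquarefree, countDegree_congr fun g hg => almostSquarefree_two_two hg]

theorem countAlmostSquarefree_one_one_zero : countAlmostSquarefree 1 1 0 = 1 := by
  have h := sum_countDegree_squarefree 0
  simp only [Nat.zero_div, zero_add, Finset.sum_range_one, pow_zero, one_mul, mul_zero,
    Nat.sub_zero] at h
  rw [← countAlmostSquarefree_degree_zero 1 1, countAlmostSquarefree_two_two, h]

theorem countAlmostSquarefree_two_two_one : countAlmostSquarefree 2 2 1 = 2 := by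
  rw [countAlmostSquarefree_two_two]
  simpa using sum_countDegree_squarefree 1

theorem countAlmostSquarefree_two_two_add_two (n : ℕ) :
    countAlmostSquarefree 2 2 (n + 2) = 2 ^ (n + 1) := by
  rw [countAlmostSquarefree_two_two, countDegree_squarefree_add_two]

theorem countAlmostSquarefree_one_two_succ (n : ℕ) :
    countAlmostSquarefree 1 2 (n + 1) =
      countAlmostSquarefree 1 1 (n + 1) + countAlmostSquarefree 1 1 n :=
  countAlmostSquarefree_succ_right 1 1 n

theorem countAlmostSquarefree_two_two_succ (n : ℕ) :
    countAlmostSquarefree 2 2 (n + 1) =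
      countAlmostSquarefree 1 2 (n + 1) + countAlmostSquarefree 1 2 n :=
  countAlmostSquarefree_succ_left 1 2 n

theorem countAlmostSquarefree_one_one_one : countAlmostSquarefree 1 1 1 = 0 := by
  have h₁ := countAlmostSquarefree_two_two_succ 0
  have h₂ := countAlmostSquarefree_one_two_succ 0
  rw [countAlmostSquarefree_degree_zero 0 1] at h₁
  simp only [zero_add, countAlmostSquarefree_two_two_one,
    countAlmostSquarefree_one_one_zero] at h₁ h₂
  lia

theorem countAlmostSquarefree_one_one (n : ℕ) :
    (countAlmostSquarefree 1 1 n : ℤ) * 9 = 2 ^ (n + 1) + (-1) ^ n * (7 - 3 * (n : ℤ)) := by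
  induction n using Nat.twoStepInduction with
  | zero => rw [countAlmostSquarefree_one_one_zero]; norm_num
  | one => rw [countAlmostSquarefree_one_one_one]; norm_num
  | more n ih₀ ih₁ =>
    have h := countAlmostSquarefree_two_two_succ (n + 1)
    rw [countAlmostSquarefree_two_two_add_two, countAlmostSquarefree_one_two_succ,
      countAlmostSquarefree_one_two_succ] at h
    zify at h
    push_cast at ih₁ ⊢
    linear_combination -9 * h - 2 * ih₁ - ih₀

theorem countAlmostSquarefree_one_three_add_two (n : ℕ) :
    countAlmostSquarefree 1 3 (n + 2) = countAlmostSquarefree 1 1 (n + 2) +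
      countAlmostSquarefree 1 1 (n + 1) + countAlmostSquarefree 1 1 n := by
  rw [countAlmostSquarefree_succ_right 1 2, countAlmostSquarefree_one_two_succ]
  exact (add_assoc _ _ _).symm

theorem countAlmostSquarefree_three_three_add_two (n : ℕ) :
    countAlmostSquarefree 3 3 (n + 2) = countAlmostSquarefree 1 3 (n + 2) +
      countAlmostSquarefree 1 3 (n + 1) + countAlmostSquarefree 1 3 n := by
  rw [countAlmostSquarefree_succ_left 2 3, countAlmostSquarefree_succ_left 1 3]
  exact (add_assoc _ _ _).symm

theorem countAlmostSquarefree_one_three_zero : countAlmostSquarefree 1 3 0 = 1 := by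
  rw [countAlmostSquarefree_degree_zero 0 2, countAlmostSquarefree_one_one_zero]

theorem countAlmostSquarefree_one_three_one : countAlmostSquarefree 1 3 1 = 1 := by
  rw [countAlmostSquarefree_succ_right 1 2 0, countAlmostSquarefree_degree_zero 0 1, zero_add,
    countAlmostSquarefree_one_one_zero, countAlmostSquarefree_one_one_one]

end Polynomial

/-- Lemma: counting over `F₂`.
Let `T n` be the number of polynomials `g ∈ F₂[x]` of degree `n` with `x³ ∤ g`,
`(x+1)³ ∤ g`, and `P² ∤ g` for every irreducible `P` of degree `≥ 2`. Then
`T 0 = 1`, `T 1 = 2`, `T 2 = 4`, `T 3 = 6`, and for `n ≥ 4`,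
`T n = (2^{n-3}·49 + (-1)^{n-1}(3n - 13))/9`. -/
theorem count_chen_condition_F2 (T : ℕ → ℕ)
    (hT : ∀ n : ℕ, T n = Nat.card {g : Polynomial (ZMod 2) //
      g.degree = (n : WithBot ℕ) ∧
      ¬ (X : Polynomial (ZMod 2)) ^ 3 ∣ g ∧
      ¬ ((X : Polynomial (ZMod 2)) + 1) ^ 3 ∣ g ∧
      ∀ P : Polynomial (ZMod 2), Irreducible P → 2 ≤ P.natDegree → ¬ P ^ 2 ∣ g}) :
    T 0 = 1 ∧ T 1 = 2 ∧ T 2 = 4 ∧ T 3 = 6 ∧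
      ∀ n : ℕ, 4 ≤ n →
        (T n : ℤ) * 9 = 2 ^ (n - 3) * 49 + (-1) ^ (n - 1) * (3 * (n : ℤ) - 13) := by
  have hT' : T = countAlmostSquarefree 3 3 := by
    funext n
    rw [hT]
    exact Nat.card_coe_set_eq _
  have h₁₁ (n : ℕ) := countAlmostSquarefree_one_one n
  have h₁₃ (n : ℕ) := countAlmostSquarefree_one_three_add_two n
  have h₃₃ (n : ℕ) := countAlmostSquarefree_three_three_add_two n
  have h₁₁₂ := h₁₁ 2
  have h₁₁₃ := h₁₁ 3
  norm_num at h₁₁₂ h₁₁₃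
  have h0 := countAlmostSquarefree_one_one_zero
  have h1 := countAlmostSquarefree_one_one_one
  have h30 := countAlmostSquarefree_one_three_zero
  have h31 := countAlmostSquarefree_one_three_one
  have h32 := h₁₃ 0
  have h33 := h₁₃ 1
  have hT2 := h₃₃ 0
  have hT3 := h₃₃ 1
  simp only [zero_add, Nat.reduceAdd] at h32 h33 hT2 hT3
  rw [hT']
  refine ⟨?_, ?_, by lia, by lia, fun n hn => ?_⟩
  · rw [countAlmostSquarefree_degree_zero 2 2, h0]
  · rw [countAlmostSquarefree_succ_left 2 3 0, countAlmostSquarefree_degree_zero 1 2, zero_add,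
      h31, h0]
  · obtain ⟨m, rfl⟩ := Nat.exists_eq_add_of_le' hn
    rw [h₃₃, h₁₃, h₁₃, h₁₃, show m + 4 - 3 = m + 1 by lia, show m + 4 - 1 = m + 3 by lia]
    have e₀ := h₁₁ m
    have e₁ := h₁₁ (m + 1)
    have e₂ := h₁₁ (m + 2)
    have e₃ := h₁₁ (m + 3)
    have e₄ := h₁₁ (m + 4)
    push_cast at e₁ e₂ e₃ e₄ ⊢
    linear_combination e₄ + 2 * e₃ + 3 * e₂ + 2 * e₁ + e₀
end

section
/- Let q = 2 and A = F₂[t] (write x for the variable). For n ≥ 4, the number of polynomials of the form x² g with g ∈ A square-free of degree n−2 and x ∤ g equals (1/3)(2^{n−2} + (−1)^{n−1}); and the number of square-free polynomials g ∈ A of degree n−4 with x ∤ g and (x+1) ∤ g equals (1/9)(2^{n−3} + (−1)^{n−1}(3n − 19)). -/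
open Polynomial

theorem ZMod.two_polynomial_eq_one_of_isUnit {f : (ZMod 2)[X]} (hf : IsUnit f) : f = 1 := by
  obtain ⟨c, hc, rfl⟩ := Polynomial.isUnit_iff.1 hf
  have : ∀ c : ZMod 2, IsUnit c → c = 1 := by decide
  rw [this c hc, C_1]

theorem ZMod.two_polynomial_degree_eq_zero_iff {f : (ZMod 2)[X]} : f.degree = 0 ↔ f = 1 := by
  refine ⟨fun h => ?_, fun h => by simp [h]⟩
  exact ZMod.two_polynomial_eq_one_of_isUnit (Polynomial.isUnit_iff_degree_eq_zero.2 h)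

/-- A polynomial is determined by its constant coefficient and the quotient by `X`. -/
theorem Polynomial.X_mul_add_C_injective {R : Type*} [CommRing R] :
    Function.Injective fun q : R[X] × R => X * q.1 + C q.2 := by
  rintro ⟨b, c⟩ ⟨b', c'⟩ h
  have h0 : c = c' := by simpa using congrArg (fun f => coeff f 0) h
  subst h0
  have h1 : X * b = X * b' := add_right_cancel h
  rw [show b = b' from isRegular_X.left h1]

theorem Polynomial.degree_X_mul_add_C {R : Type*} [CommRing R] [IsDomain R] {b : R[X]}
    (hb : b ≠ 0) (c : R) : (X * b + C c).degree = b.degree + 1 := by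
  rw [degree_add_eq_left_of_degree_lt, degree_mul, degree_X, add_comm]
  refine degree_C_le.trans_lt ?_
  rw [degree_mul, degree_X, degree_eq_natDegree hb]
  norm_cast
  lia

theorem ZMod.two_polynomial_degree_succ_eq_image (m : ℕ) :
    {f : (ZMod 2)[X] | f.degree = ((m + 1 : ℕ) : WithBot ℕ)} =
      (fun q : (ZMod 2)[X] × ZMod 2 => X * q.1 + C q.2) ''
        ({f : (ZMod 2)[X] | f.degree = (m : WithBot ℕ)} ×ˢ Set.univ) := by
  ext f
  constructor
  · intro (hf : f.degree = _)
    refine ⟨(divX f, f.coeff 0), ⟨?_, trivial⟩, X_mul_divX_add f⟩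
    have hb : divX f ≠ 0 := by
      intro h
      have h' := X_mul_divX_add f
      rw [h, mul_zero, zero_add] at h'
      have h2 : f.degree ≤ 0 := h' ▸ degree_C_le
      rw [hf] at h2
      norm_cast at h2
    have h := degree_X_mul_add_C hb (f.coeff 0)
    rw [X_mul_divX_add, hf, degree_eq_natDegree hb] at h
    rw [Set.mem_ofPred_eq, degree_eq_natDegree hb]
    norm_cast at h ⊢
    lia
  · rintro ⟨⟨b, c⟩, ⟨hb, -⟩, rfl⟩
    have hb' : b.degree = (m : WithBot ℕ) := hb
    have hb0 : b ≠ 0 := by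
      rintro rfl
      simp at hb'
    rw [Set.mem_ofPred_eq, degree_X_mul_add_C hb0, hb']
    norm_cast

theorem ZMod.two_polynomial_finite_degree_eq (m : ℕ) :
    {f : (ZMod 2)[X] | f.degree = (m : WithBot ℕ)}.Finite := by
  induction m with
  | zero => simp [ZMod.two_polynomial_degree_eq_zero_iff]
  | succ m ih =>
    rw [ZMod.two_polynomial_degree_succ_eq_image]
    exact (ih.prod Set.finite_univ).image _

theorem ZMod.two_polynomial_ncard_degree_eq (m : ℕ) :
    {f : (ZMod 2)[X] | f.degree = (m : WithBot ℕ)}.ncard = 2 ^ m := by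
  induction m with
  | zero => simp [ZMod.two_polynomial_degree_eq_zero_iff]
  | succ m ih =>
    rw [ZMod.two_polynomial_degree_succ_eq_image,
      Set.ncard_image_of_injective _ X_mul_add_C_injective, Set.ncard_prod, ih, Set.ncard_univ,
      Nat.card_zmod, pow_succ]

theorem Polynomial.exists_squarefree_mul_sq {K : Type*} [Field K] {f : K[X]} (hf : f ≠ 0) :
    ∃ a b : K[X], Squarefree a ∧ a * b ^ 2 = f := by
  induction hn : f.natDegree using Nat.strong_induction_on generalizing f with
  | _ n ih =>
    by_cases hsq : Squarefree f
    · exact ⟨f, 1, hsq, by simp⟩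
    · simp only [Squarefree, not_forall] at hsq
      obtain ⟨d, ⟨e, rfl⟩, hd⟩ := hsq
      have hd0 : d ≠ 0 := by rintro rfl; simp at hf
      have he0 : e ≠ 0 := by rintro rfl; simp at hf
      have hpos : 0 < d.natDegree :=
        natDegree_pos_iff_degree_pos.2 (degree_pos_of_ne_zero_of_nonunit hd0 hd)
      rw [natDegree_mul (mul_ne_zero hd0 hd0) he0, natDegree_mul hd0 hd0] at hn
      obtain ⟨a, b, ha, rfl⟩ := ih e.natDegree (by lia) he0 rfl
      exact ⟨a, d * b, ha, by ring⟩

theorem Squarefree.dvd_of_sq_dvd_mul_sq {K : Type*} [Field K] {c b d : K[X]}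
    (hc : Squarefree c) (hb : b ≠ 0) (h : b ^ 2 ∣ c * d ^ 2) : b ∣ d := by
  obtain ⟨b', d', g, hcop, rfl, rfl⟩ :=
    UniqueFactorizationMonoid.exists_reduced_factors b hb d
  rw [mul_pow, mul_pow, mul_left_comm,
    mul_dvd_mul_iff_left (pow_ne_zero 2 (left_ne_zero_of_mul hb))] at h
  have hu : IsUnit b' := hc b' (sq b' ▸ hcop.isCoprime.pow.dvd_of_dvd_mul_right h)
  exact mul_dvd_mul_left g hu.dvd

theorem ZMod.two_polynomial_mul_sq_injOn :
    Set.InjOn (fun q : (ZMod 2)[X] × (ZMod 2)[X] => q.1 * q.2 ^ 2)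
      {q | Squarefree q.1 ∧ q.2 ≠ 0} := by
  rintro ⟨a, b⟩ ⟨ha, hb⟩ ⟨c, d⟩ ⟨hc, hd⟩ h
  simp only at ha hb hc hd h
  have hbd : b ∣ d := hc.dvd_of_sq_dvd_mul_sq hb (h ▸ Dvd.intro_left _ rfl)
  have hdb : d ∣ b := ha.dvd_of_sq_dvd_mul_sq hd (h ▸ Dvd.intro_left _ rfl)
  obtain ⟨u, hu⟩ := associated_of_dvd_dvd hbd hdb
  rw [ZMod.two_polynomial_eq_one_of_isUnit u.isUnit, mul_one] at hu
  subst hu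
  rw [mul_right_cancel₀ (pow_ne_zero 2 hb) h]

/-- Pairs `(a, b)` with `a` squarefree such that `a * b ^ 2` has degree `m`. -/
def squarefreeSqPairs (m : ℕ) : Set ((ZMod 2)[X] × (ZMod 2)[X]) :=
  {q | Squarefree q.1 ∧ q.2 ≠ 0 ∧ (q.1 * q.2 ^ 2).degree = (m : WithBot ℕ)}

theorem image_squarefreeSqPairs (m : ℕ) :
    (fun q : (ZMod 2)[X] × (ZMod 2)[X] => q.1 * q.2 ^ 2) '' squarefreeSqPairs m =
      {f : (ZMod 2)[X] | f.degree = (m : WithBot ℕ)} := by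
  ext f
  constructor
  · rintro ⟨q, ⟨-, -, h⟩, rfl⟩
    exact h
  · intro hf
    have hf0 : f ≠ 0 := by
      rintro rfl
      simp at hf
    obtain ⟨a, b, ha, rfl⟩ := exists_squarefree_mul_sq hf0
    refine ⟨(a, b), ⟨ha, ?_, hf⟩, rfl⟩
    rintro rfl
    simp at hf0

theorem injOn_squarefreeSqPairs (m : ℕ) :
    Set.InjOn (fun q : (ZMod 2)[X] × (ZMod 2)[X] => q.1 * q.2 ^ 2) (squarefreeSqPairs m) := by
  refine ZMod.two_polynomial_mul_sq_injOn.mono ?_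
  rintro q ⟨h1, h2, -⟩
  exact ⟨h1, h2⟩

theorem ncard_squarefreeSqPairs (m : ℕ) : (squarefreeSqPairs m).ncard = 2 ^ m := by
  rw [← (injOn_squarefreeSqPairs m).ncard_image, image_squarefreeSqPairs,
    ZMod.two_polynomial_ncard_degree_eq]

theorem finite_squarefreeSqPairs (m : ℕ) : (squarefreeSqPairs m).Finite :=
  Set.Finite.of_finite_image (image_squarefreeSqPairs m ▸ ZMod.two_polynomial_finite_degree_eq m)
    (injOn_squarefreeSqPairs m)

/-- The squarefree polynomials over `𝔽₂` of degree `m`. -/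
def squarefreeDegree (m : ℕ) : Set (ZMod 2)[X] :=
  {g | Squarefree g ∧ g.degree = (m : WithBot ℕ)}

theorem ncard_squarefreeDegree_of_lt_two {m : ℕ} (hm : m < 2) :
    (squarefreeDegree m).ncard = 2 ^ m := by
  rw [← ncard_squarefreeSqPairs,
    ← Set.ncard_image_of_injective (squarefreeDegree m) (Prod.mk_left_injective (1 : (ZMod 2)[X]))]
  congr 1
  ext ⟨a, b⟩
  constructor
  · rintro ⟨a, ⟨h1, h2⟩, h⟩
    cases h
    exact ⟨h1, one_ne_zero, by simpa using h2⟩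
  · rintro ⟨h1, h2, h3⟩
    simp only at h1 h2 h3
    have hb : b = 1 := by
      rw [← ZMod.two_polynomial_degree_eq_zero_iff, degree_eq_natDegree h2]
      rw [degree_mul, degree_pow, two_nsmul, degree_eq_natDegree h2,
          degree_eq_natDegree h1.ne_zero] at h3
      norm_cast at h3 ⊢
      lia
    subst hb
    exact ⟨a, ⟨h1, by simpa using h3⟩, rfl⟩

theorem squarefreeSqPairs_add_two (m : ℕ) :
    squarefreeSqPairs (m + 2) = (fun a => (a, 1)) '' squarefreeDegree (m + 2) ∪
      (fun q : ((ZMod 2)[X] × (ZMod 2)[X]) × ZMod 2 => (q.1.1, X * q.1.2 + C q.2)) ''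
        (squarefreeSqPairs m ×ˢ Set.univ) := by
  ext ⟨a, b⟩
  constructor
  · rintro ⟨h1, h2, h3⟩
    simp only at h1 h2 h3
    by_cases hb : divX b = 0
    · left
      have hb1 : b = 1 := by
        rw [← ZMod.two_polynomial_degree_eq_zero_iff]
        have h := X_mul_divX_add b
        rw [hb, mul_zero, zero_add] at h
        rw [← h] at h2 ⊢
        exact degree_C (by simpa using h2)
      subst hb1
      exact ⟨a, ⟨h1, by simpa using h3⟩, rfl⟩
    · right
      refine ⟨((a, divX b), b.coeff 0), ⟨⟨h1, hb, ?_⟩, trivial⟩, ?_⟩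
      · have h := degree_X_mul_add_C hb (b.coeff 0)
        rw [X_mul_divX_add] at h
        rw [degree_mul, degree_pow, two_nsmul, h, degree_eq_natDegree hb,
          degree_eq_natDegree h1.ne_zero] at h3
        simp only [degree_mul, degree_pow, two_nsmul]
        rw [degree_eq_natDegree hb, degree_eq_natDegree h1.ne_zero]
        norm_cast at h3 ⊢
        lia
      · simp only [X_mul_divX_add]
  · rintro (⟨a, ⟨h1, h2⟩, h⟩ | ⟨⟨⟨a, b⟩, c⟩, ⟨⟨h1, h2, h3⟩, -⟩, h⟩)
    · cases h
      exact ⟨h1, one_ne_zero, by simpa using h2⟩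
    · cases h
      simp only at h1 h2 h3
      have hd := degree_X_mul_add_C h2 c
      refine ⟨h1, ?_, ?_⟩
      · intro h0
        simp only at h0
        rw [h0, degree_eq_natDegree h2, degree_zero] at hd
        norm_cast at hd
      · rw [degree_mul, degree_pow, two_nsmul, degree_eq_natDegree h2,
          degree_eq_natDegree h1.ne_zero] at h3
        simp only [degree_mul, degree_pow, two_nsmul]
        rw [hd, degree_eq_natDegree h2, degree_eq_natDegree h1.ne_zero]
        norm_cast at h3 ⊢
        lia

theorem ncard_squarefreeDegree_add_two (m : ℕ) :
    (squarefreeDegree (m + 2)).ncard = 2 ^ (m + 1) := by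
  have hfin := finite_squarefreeSqPairs (m + 2)
  have hcard := ncard_squarefreeSqPairs (m + 2)
  rw [squarefreeSqPairs_add_two] at hfin hcard
  rw [Set.ncard_union_eq ?_ (hfin.subset Set.subset_union_left)
    (hfin.subset Set.subset_union_right), Set.ncard_image_of_injective _
    (Prod.mk_left_injective (1 : (ZMod 2)[X])), Set.ncard_image_of_injective, Set.ncard_prod,
    ncard_squarefreeSqPairs, Set.ncard_univ, Nat.card_zmod] at hcard
  · rw [pow_succ, pow_succ] at *
    lia
  · rintro ⟨⟨a, b⟩, c⟩ ⟨⟨a', b'⟩, c'⟩ h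
    simp only [Prod.mk.injEq] at h
    have := @X_mul_add_C_injective (ZMod 2) _ (b, c) (b', c') h.2
    simp_all
  · rw [Set.disjoint_left]
    rintro _ ⟨a, -, rfl⟩ ⟨⟨⟨a', b⟩, c⟩, ⟨⟨-, h2, -⟩, -⟩, h⟩
    simp only [Prod.mk.injEq] at h h2
    have hd := degree_X_mul_add_C h2 c
    rw [h.2, degree_one, degree_eq_natDegree h2] at hd
    norm_cast at hd

theorem ncard_degree_succ_eq_add_of_not_dvd {E : Set (ZMod 2)[X]} {p : (ZMod 2)[X]}
    (hp : p.degree = 1) (hE : ∀ g ∈ E, Squarefree g)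
    (hpE : ∀ g, ¬ p ∣ g → (p * g ∈ E ↔ g ∈ E)) (m : ℕ) :
    {g ∈ E | g.degree = ((m + 1 : ℕ) : WithBot ℕ)}.ncard =
      {g ∈ E | g.degree = ((m + 1 : ℕ) : WithBot ℕ) ∧ ¬ p ∣ g}.ncard +
      {g ∈ E | g.degree = (m : WithBot ℕ) ∧ ¬ p ∣ g}.ncard := by
  have hp0 : p ≠ 0 := by
    rintro rfl
    simp at hp
  have hunion : {g ∈ E | g.degree = ((m + 1 : ℕ) : WithBot ℕ)} =
      {g ∈ E | g.degree = ((m + 1 : ℕ) : WithBot ℕ) ∧ ¬ p ∣ g} ∪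
      (fun g => p * g) '' {g ∈ E | g.degree = (m : WithBot ℕ) ∧ ¬ p ∣ g} := by
    ext f
    constructor
    · rintro ⟨h1, h2⟩
      by_cases hpf : p ∣ f
      · right
        obtain ⟨g, rfl⟩ := hpf
        have hpg : ¬ p ∣ g := by
          intro h
          have hu := hE _ h1 p (mul_dvd_mul_left p h)
          rw [Polynomial.isUnit_iff_degree_eq_zero, hp] at hu
          exact one_ne_zero hu
        have hg0 : g ≠ 0 := by
          rintro rfl
          simp at hpg
        refine ⟨g, ⟨(hpE g hpg).1 h1, ?_, hpg⟩, rfl⟩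
        rw [degree_mul, hp, degree_eq_natDegree hg0] at h2
        rw [degree_eq_natDegree hg0]
        norm_cast at h2 ⊢
        lia
      · exact Or.inl ⟨h1, h2, hpf⟩
    · rintro (⟨h1, h2, -⟩ | ⟨g, ⟨h1, h2, h3⟩, rfl⟩)
      · exact ⟨h1, h2⟩
      · refine ⟨(hpE g h3).2 h1, ?_⟩
        rw [degree_mul, hp, h2]
        norm_cast
        lia
  have hfin := ZMod.two_polynomial_finite_degree_eq
  rw [hunion, Set.ncard_union_eq ?_ ((hfin (m + 1)).subset fun _ h => h.2.1)
    (((hfin m).subset fun _ h => h.2.1).image _),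
    Set.ncard_image_of_injective _ (mul_right_injective₀ hp0)]
  rw [Set.disjoint_left]
  rintro _ ⟨-, -, h⟩ ⟨g, -, rfl⟩
  exact h (dvd_mul_right p g)

theorem Polynomial.squarefree_mul_iff_of_degree_eq_one {K : Type*} [Field K] {p g : K[X]}
    (hp : p.degree = 1) (hg : ¬ p ∣ g) : Squarefree (p * g) ↔ Squarefree g := by
  have hirr := irreducible_of_degree_eq_one hp
  rw [squarefree_mul_iff]
  exact ⟨fun h => h.2.2, fun h => ⟨(hirr.coprime_iff_not_dvd.2 hg).isRelPrime, hirr.squarefree, h⟩⟩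

theorem ncard_squarefreeDegree_not_X_dvd_succ (m : ℕ) :
    ({g ∈ squarefreeDegree (m + 1) | ¬ X ∣ g}.ncard : ℤ) * 3 = 2 ^ (m + 1) + (-1) ^ m := by
  have hrec (k : ℕ) : (squarefreeDegree (k + 1)).ncard =
      {g ∈ squarefreeDegree (k + 1) | ¬ X ∣ g}.ncard +
        {g ∈ squarefreeDegree k | ¬ X ∣ g}.ncard := by
    simpa only [squarefreeDegree, Set.mem_ofPred_eq, and_assoc] using
      ncard_degree_succ_eq_add_of_not_dvd (E := {g | Squarefree g}) degree_X (fun _ h => h)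
        (fun _ h => squarefree_mul_iff_of_degree_eq_one degree_X h) k
  induction m with
  | zero =>
    have h0 : {g ∈ squarefreeDegree 0 | ¬ X ∣ g} = {1} := by
      ext g
      simp only [squarefreeDegree, Set.mem_ofPred_eq, Nat.cast_zero,
        ZMod.two_polynomial_degree_eq_zero_iff, Set.mem_singleton_iff]
      refine ⟨fun h => h.1.2, ?_⟩
      rintro rfl
      exact ⟨⟨squarefree_one, rfl⟩, fun h => not_isUnit_X (isUnit_of_dvd_one h)⟩
    have h := hrec 0
    rw [h0, ncard_squarefreeDegree_of_lt_two (by norm_num), Set.ncard_singleton] at h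
    have h1 : {g ∈ squarefreeDegree (0 + 1) | ¬ X ∣ g}.ncard = 1 := by lia
    rw [h1]
    norm_num
  | succ m ih =>
    have h := hrec (m + 1)
    rw [ncard_squarefreeDegree_add_two] at h
    zify at h
    rw [pow_succ] at h ih ⊢
    rw [pow_succ, pow_succ (-1 : ℤ)]
    linarith

theorem ncard_squarefreeDegree_not_X_dvd_not_X_add_one_dvd (m : ℕ) :
    ({g ∈ squarefreeDegree m | ¬ X ∣ g ∧ ¬ X + 1 ∣ g}.ncard : ℤ) * 9 =
      2 ^ (m + 1) + (-1) ^ (m + 1) * (3 * (m : ℤ) - 7) := by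
  have hdeg : (X + 1 : (ZMod 2)[X]).degree = 1 := by
    simpa using degree_X_add_C (1 : ZMod 2)
  have hX : ¬ (X : (ZMod 2)[X]) ∣ X + 1 := by
    simp [X_dvd_iff]
  have hrec (k : ℕ) : {g ∈ squarefreeDegree (k + 1) | ¬ X ∣ g}.ncard =
      {g ∈ squarefreeDegree (k + 1) | ¬ X ∣ g ∧ ¬ X + 1 ∣ g}.ncard +
        {g ∈ squarefreeDegree k | ¬ X ∣ g ∧ ¬ X + 1 ∣ g}.ncard := by
    have h := ncard_degree_succ_eq_add_of_not_dvd
      (E := {g | Squarefree g ∧ ¬ X ∣ g}) hdeg (fun _ h => h.1)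
        (fun g h => by
          simp only [Set.mem_ofPred_eq, squarefree_mul_iff_of_degree_eq_one hdeg h,
            prime_X.dvd_mul, hX, false_or]) k
    simp only [squarefreeDegree, Set.mem_ofPred_eq] at h ⊢
    simpa only [and_assoc, and_comm, and_left_comm] using h
  induction m with
  | zero =>
    have h0 : {g ∈ squarefreeDegree 0 | ¬ X ∣ g ∧ ¬ X + 1 ∣ g} = {1} := by
      ext g
      simp only [squarefreeDegree, Set.mem_ofPred_eq, Nat.cast_zero,
        ZMod.two_polynomial_degree_eq_zero_iff, Set.mem_singleton_iff]
      refine ⟨fun h => h.1.2, ?_⟩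
      rintro rfl
      exact ⟨⟨squarefree_one, rfl⟩, fun h => not_isUnit_X (isUnit_of_dvd_one h),
        fun h => (irreducible_of_degree_eq_one hdeg).not_isUnit (isUnit_of_dvd_one h)⟩
    rw [h0]
    simp
  | succ m ih =>
    have h := hrec m
    have h' := ncard_squarefreeDegree_not_X_dvd_succ m
    zify at h
    rw [pow_succ (-1 : ℤ) m] at ih
    rw [pow_succ (-1 : ℤ), pow_succ (-1 : ℤ), pow_succ (2 : ℤ) (m + 1)]
    push_cast
    linarith

/-- Counting lemmas over `F₂` used for `U₂(n)` and `U₄(n)`.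
For `n ≥ 4`: the number of polynomials of the form `x² g` with `g` square-free of
degree `n-2` and `x ∤ g` equals `(1/3)(2^{n-2} + (-1)^{n-1})`; and the number of
square-free polynomials `g` of degree `n-4` with `x ∤ g` and `(x+1) ∤ g` equals
`(1/9)(2^{n-3} + (-1)^{n-1}(3n - 19))`. -/
theorem count_squarefree_F2 :
    (∀ n : ℕ, 4 ≤ n →
      (Nat.card {h : Polynomial (ZMod 2) //
          ∃ g : Polynomial (ZMod 2), h = X ^ 2 * g ∧ Squarefree g ∧
            g.degree = ((n - 2 : ℕ) : WithBot ℕ) ∧ ¬ (X : Polynomial (ZMod 2)) ∣ g} : ℤ) * 3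
        = 2 ^ (n - 2) + (-1) ^ (n - 1)) ∧
    (∀ n : ℕ, 4 ≤ n →
      (Nat.card {g : Polynomial (ZMod 2) // Squarefree g ∧
          g.degree = ((n - 4 : ℕ) : WithBot ℕ) ∧ ¬ (X : Polynomial (ZMod 2)) ∣ g ∧
          ¬ ((X : Polynomial (ZMod 2)) + 1) ∣ g} : ℤ) * 9
        = 2 ^ (n - 3) + (-1) ^ (n - 1) * (3 * (n : ℤ) - 19)) := by
  constructor
  · intro n hn
    obtain ⟨m, rfl⟩ := Nat.exists_eq_add_of_le hn
    have h := ncard_squarefreeDegree_not_X_dvd_succ (m + 1)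
    rw [← Set.ncard_image_of_injective _
      (mul_right_injective₀ (pow_ne_zero 2 (X_ne_zero (R := ZMod 2))))] at h
    rw [show 4 + m - 2 = m + 1 + 1 by lia, show 4 + m - 1 = m + 1 + 2 by lia, pow_add (-1 : ℤ) _ 2,
      neg_one_sq, mul_one, ← h, ← Nat.card_coe_set_eq]
    have himage : (fun g : (ZMod 2)[X] => X ^ 2 * g) ''
          {g ∈ squarefreeDegree (m + 1 + 1) | ¬ X ∣ g} =
        {f | ∃ g, f = X ^ 2 * g ∧ Squarefree g ∧ g.degree = ((m + 1 + 1 : ℕ) : WithBot ℕ) ∧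
          ¬ X ∣ g} := by
      ext f
      constructor
      · rintro ⟨g, ⟨⟨h1, h2⟩, h3⟩, rfl⟩
        exact ⟨g, rfl, h1, h2, h3⟩
      · rintro ⟨g, rfl, h1, h2, h3⟩
        exact ⟨g, ⟨⟨h1, h2⟩, h3⟩, rfl⟩
    rw [himage]
    rfl
  · intro n hn
    obtain ⟨m, rfl⟩ := Nat.exists_eq_add_of_le hn
    have h := ncard_squarefreeDegree_not_X_dvd_not_X_add_one_dvd m
    rw [show 4 + m - 4 = m by lia, show 4 + m - 3 = m + 1 by lia,
      show 4 + m - 1 = m + 1 + 2 by lia, pow_add (-1 : ℤ) _ 2, neg_one_sq, mul_one]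
    rw [show (3 * ((4 + m : ℕ) : ℤ) - 19) = 3 * (m : ℤ) - 7 by push_cast; ring, ← h,
      ← Nat.card_coe_set_eq]
    simp only [squarefreeDegree, Set.mem_ofPred_eq, and_assoc]
    rfl
end

section
/- Let P ∈ A be monic irreducible of degree d, k ≥ 1 an integer, {b'_i}_{i=1}^k a re-ordering of b₁, …, b_k by increasing P-adic valuation, and {u_i}_{i=1}^k a P-sequence over A. Then for every non-empty subset J ⊆ {1, 2, …, k} and all h₁, h₂ ∈ A, v_P(∏_{j∈J}(h₁ − u_j) − ∏_{j∈J}(h₂ − u_j)) ≥ v_P(h₁ − h₂) + Σ_{i=1}^{|J|−1} v_P(b'_i). -/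
open Polynomial

noncomputable section

variable {F : Type*} [Field F] [Fintype F]

/-- The `P`-adic valuation on `A = F_q[t]` (with `v_P 0 = ∞`), as the multiplicity
of `P` valued in `ℕ∞`. -/
def vP (P h : Polynomial F) : ℕ∞ := emultiplicity P h

/-- `b : ℕ → A` is an admissible enumeration attached to the monic irreducible `P`
of degree `d` (with `q = #F`): `b 0 = 0`, `b 1 = 1`, the restriction of `b` to
`{0, …, q^d - 1}` is a bijection onto the polynomials of degree `< d`, sorted by
non-decreasing degree (for indices `≥ 1`), and `b` is extended to all of `ℕ` by
`b k = Σ_i b_{l_i} P^i` where `k = Σ_i l_i q^{d i}` is the `q^d`-adic expansion,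
equivalently `b k = b (k % q^d) + P · b (k / q^d)`. -/
def IsBSeq (P : Polynomial F) (b : ℕ → Polynomial F) : Prop :=
  b 0 = 0 ∧ b 1 = 1 ∧
  Set.BijOn b (Set.Iio (Fintype.card F ^ P.natDegree))
    {h : Polynomial F | h.degree < (P.natDegree : WithBot ℕ)} ∧
  (∀ i j : ℕ, 1 ≤ i → i ≤ j → j < Fintype.card F ^ P.natDegree →
    (b i).degree ≤ (b j).degree) ∧
  ∀ k : ℕ, b k = b (k % Fintype.card F ^ P.natDegree)
    + P * b (k / Fintype.card F ^ P.natDegree)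

theorem card_filter_natCast_le (x : ℕ∞) (M : ℕ) :
    (((Finset.Icc 1 M).filter fun m : ℕ => (m : ℕ∞) ≤ x).card : ℕ∞) = min x M := by
  classical
  induction x using ENat.recTopCoe with
  | top => simp
  | coe n =>
    have h : ((Finset.Icc 1 M).filter fun m : ℕ => (m : ℕ∞) ≤ n) = Finset.Icc 1 (min n M) := by
      ext m
      simp only [Finset.mem_filter, Finset.mem_Icc, Nat.cast_le, le_min_iff]
      omega
    rw [h, Nat.card_Icc, Nat.add_sub_cancel]
    exact Nat.mono_cast.map_min

theorem sum_min_natCast_eq_sum_card {ι : Type*} (s : Finset ι) (f : ι → ℕ∞) (M : ℕ) :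
    ∑ i ∈ s, min (f i) M =
      ((∑ m ∈ Finset.Icc 1 M, (s.filter fun i => (m : ℕ∞) ≤ f i).card : ℕ) : ℕ∞) := by
  simp_rw [← card_filter_natCast_le, Finset.card_filter]
  rw [Finset.sum_comm, Nat.cast_sum]

/-- A layer-cake comparison of sums of extended natural numbers. -/
theorem sum_le_sum_of_card_superlevel_le {ι κ : Type*} (s : Finset ι) (t : Finset κ)
    (f : ι → ℕ∞) (g : κ → ℕ∞) (M : ℕ) (hf : ∀ i ∈ s, f i ≤ M)
    (h : ∀ m : ℕ, (s.filter fun i => (m : ℕ∞) ≤ f i).card ≤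
      (t.filter fun i => (m : ℕ∞) ≤ g i).card) :
    ∑ i ∈ s, f i ≤ ∑ i ∈ t, g i := by
  calc ∑ i ∈ s, f i = ∑ i ∈ s, min (f i) M :=
        Finset.sum_congr rfl fun i hi => (min_eq_left (hf i hi)).symm
    _ ≤ ∑ i ∈ t, min (g i) M := by
        rw [sum_min_natCast_eq_sum_card, sum_min_natCast_eq_sum_card]
        exact_mod_cast Finset.sum_le_sum fun m _ => h m
    _ ≤ ∑ i ∈ t, g i := Finset.sum_le_sum fun i _ => min_le_left _ _

/-- If `p` holds somewhere in every window of length `N` inside `(a, a + L]`, then it holds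
at least `L / N` times there. -/
theorem div_le_card_filter_Ioc (p : ℕ → Prop) [DecidablePred p] {N : ℕ} (hN : 0 < N) (a L : ℕ)
    (h : ∀ c, a ≤ c → c + N ≤ a + L → ∃ i ∈ Finset.Ioc c (c + N), p i) :
    L / N ≤ ((Finset.Ioc a (a + L)).filter p).card := by
  induction L using Nat.strong_induction_on with
  | _ L ih =>
    rcases lt_or_ge L N with hL | hL
    · simp [Nat.div_eq_of_lt hL]
    · obtain ⟨i, hi, hpi⟩ := h (a + (L - N)) (by omega) (by omega)
      rw [Finset.mem_Ioc] at hi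
      have ih' := ih (L - N) (by omega) fun c hc hc' => h c hc (by omega)
      have hlt : ((Finset.Ioc a (a + (L - N))).filter p).card <
          ((Finset.Ioc a (a + L)).filter p).card := by
        apply Finset.card_lt_card
        rw [Finset.ssubset_iff]
        refine ⟨i, by simp; omega, ?_⟩
        intro x
        simp only [Finset.mem_insert, Finset.mem_filter, Finset.mem_Ioc]
        rintro (rfl | ⟨hx, hpx⟩)
        · exact ⟨by omega, hpi⟩
        · exact ⟨by omega, hpx⟩
      rw [Nat.div_eq_sub_div hN hL]
      omega

theorem le_emultiplicity_sum {ι R : Type*} [CommRing R] (p : R) (s : Finset ι) (f : ι → R)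
    (c : ℕ∞) (h : ∀ i ∈ s, c ≤ emultiplicity p (f i)) : c ≤ emultiplicity p (∑ i ∈ s, f i) := by
  classical
  induction s using Finset.induction_on with
  | empty => simp
  | insert a s ha ih =>
    rw [Finset.sum_insert ha]
    refine le_trans (le_min (h a (by simp)) (ih fun i hi => h i (by simp [hi]))) ?_
    exact min_le_emultiplicity_add

theorem card_pow_dvd_of_le_vP {P : Polynomial F} {b : ℕ → Polynomial F} (hP : P.Monic)
    (hb : IsBSeq P b) (m : ℕ) :
    ∀ i, (m : ℕ∞) ≤ vP P (b i) → (Fintype.card F ^ P.natDegree) ^ m ∣ i := by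
  obtain ⟨hb0, -, hbij, -, hrec⟩ := hb
  set Q := Fintype.card F ^ P.natDegree with hQ
  have hQpos : 0 < Q := pow_pos Fintype.card_pos _
  induction m with
  | zero => simp
  | succ m ih =>
    intro i hi
    have hdvd : P ^ (m + 1) ∣ b i := pow_dvd_of_le_emultiplicity hi
    have hmod : i % Q ∈ Set.Iio Q := Nat.mod_lt i hQpos
    have hzero : b (i % Q) = 0 := by
      have h1 : P ∣ b (i % Q) := by
        have h2 : P ∣ b i := (dvd_pow_self P m.succ_ne_zero).trans hdvd
        rw [hrec i] at h2
        exact (dvd_add_left (dvd_mul_right _ _)).1 h2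
      refine eq_zero_of_dvd_of_degree_lt h1 ?_
      rw [degree_eq_natDegree hP.ne_zero]
      exact hbij.mapsTo hmod
    have hi0 : i % Q = 0 :=
      hbij.injOn hmod (Set.mem_Iio.2 hQpos) (hzero.trans hb0.symm)
    rw [hrec i, hzero, zero_add, pow_succ', mul_dvd_mul_iff_left hP.ne_zero] at hdvd
    have h3 := mul_dvd_mul_left Q (ih (i / Q) (le_emultiplicity_of_pow_dvd hdvd))
    rwa [← pow_succ', Nat.mul_div_cancel' (Nat.dvd_of_mod_eq_zero hi0)] at h3

/-- A family of pairwise incongruent polynomials modulo `g` with as many members as there are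
residue classes meets every residue class. -/
theorem exists_dvd_sub_of_card_le {g : Polynomial F} (hg : g.Monic) (s : Finset ℕ)
    (u : ℕ → Polynomial F) (hs : Fintype.card F ^ g.natDegree ≤ s.card)
    (hu : ∀ i ∈ s, ∀ j ∈ s, g ∣ u i - u j → i = j) (h : Polynomial F) :
    ∃ i ∈ s, g ∣ h - u i := by
  classical
  let E := (degreeLTEquiv F g.natDegree).toEquiv
  let : Fintype (degreeLT F g.natDegree) := Fintype.ofEquiv _ E.symm
  have hcard : Fintype.card (degreeLT F g.natDegree) = Fintype.card F ^ g.natDegree := by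
    rw [Fintype.card_congr E]
    simp
  let r : Polynomial F → degreeLT F g.natDegree := fun f =>
    ⟨f %ₘ g, mem_degreeLT.2 (by
      rw [← degree_eq_natDegree hg.ne_zero]
      exact degree_modByMonic_lt f hg)⟩
  have hr : ∀ f f', r f = r f' → g ∣ f - f' := by
    intro f f' hff
    have h1 : f %ₘ g = f' %ₘ g := congrArg Subtype.val hff
    rw [← modByMonic_eq_zero_iff_dvd hg, sub_modByMonic, h1, sub_self]
  have himg : s.image (fun i => r (u i)) = Finset.univ := by
    apply Finset.eq_univ_of_card
    refine le_antisymm (Finset.card_le_univ _) ?_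
    rw [Finset.card_image_of_injOn fun i hi j hj hij => hu i hi j hj (hr _ _ hij), hcard]
    exact hs
  obtain ⟨i, hi, hri⟩ := Finset.mem_image.1 (himg ▸ Finset.mem_univ (r h))
  exact ⟨i, hi, hr _ _ hri.symm⟩

/-- Among the initial part of a sequence sorted increasingly, the number of large terms is
bounded by the total number of large terms minus the number of omitted terms. -/
theorem card_filter_Icc_le_of_monotone (v : ℕ → ℕ∞) {k n : ℕ} (hn : 1 ≤ n) (hnk : n ≤ k)
    (hmono : ∀ i j : ℕ, 1 ≤ i → i ≤ j → j ≤ k → v i ≤ v j) (m : ℕ∞) :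
    ((Finset.Icc 1 (n - 1)).filter fun i => m ≤ v i).card ≤
      ((Finset.Icc 1 k).filter fun i => m ≤ v i).card - (k - n + 1) := by
  classical
  rcases Finset.eq_empty_or_nonempty ((Finset.Icc 1 (n - 1)).filter fun i => m ≤ v i) with h | h
  · simp [h]
  · obtain ⟨i₀, hi₀⟩ := h
    simp only [Finset.mem_filter, Finset.mem_Icc] at hi₀
    have hdisj : Disjoint ((Finset.Icc 1 (n - 1)).filter fun i => m ≤ v i) (Finset.Icc n k) := by
      rw [Finset.disjoint_left]
      intro i hi
      simp only [Finset.mem_filter, Finset.mem_Icc] at hi ⊢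
      omega
    have hsub : ((Finset.Icc 1 (n - 1)).filter fun i => m ≤ v i) ∪ Finset.Icc n k ⊆
        (Finset.Icc 1 k).filter fun i => m ≤ v i := by
      intro i
      simp only [Finset.mem_union, Finset.mem_filter, Finset.mem_Icc]
      rintro (⟨h1, h2⟩ | h1)
      · exact ⟨by omega, h2⟩
      · exact ⟨by omega, hi₀.2.trans (hmono i₀ i hi₀.1.1 (by omega) h1.2)⟩
    have hc := Finset.card_le_card hsub
    rw [Finset.card_union_of_disjoint hdisj, Nat.card_Icc] at hc
    omega

/-- A product over `J` that switches from `h₁` to `h₂` at the index `j`, with the factor at `j`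
omitted, has many factors in the zero class modulo every window length `N`. -/
theorem div_sub_le_card_filter_switch (p₁ p₂ : ℕ → Prop) [DecidablePred p₁] [DecidablePred p₂]
    {N k : ℕ} (hN : 0 < N)
    (h₁ : ∀ c, c + N ≤ k → ∃ i ∈ Finset.Ioc c (c + N), p₁ i)
    (h₂ : ∀ c, c + N ≤ k → ∃ i ∈ Finset.Ioc c (c + N), p₂ i)
    {J : Finset ℕ} (hJ : J ⊆ Finset.Icc 1 k) {j : ℕ} (hj : j ∈ J) :
    k / N - (k - J.card + 1) ≤
      ((J.erase j).filter fun i => if i < j then p₁ i else p₂ i).card := by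
  classical
  have hjk := Finset.mem_Icc.1 (hJ hj)
  have c₁ := div_le_card_filter_Ioc p₁ hN 0 (j - 1) fun c _ hc => h₁ c (by omega)
  have c₂ := div_le_card_filter_Ioc p₂ hN j (k - j) fun c _ hc => h₂ c (by omega)
  rw [zero_add] at c₁
  rw [show j + (k - j) = k by omega] at c₂
  have hdisj : Disjoint ((Finset.Ioc 0 (j - 1)).filter p₁) ((Finset.Ioc j k).filter p₂) := by
    rw [Finset.disjoint_left]
    intro i hi
    simp only [Finset.mem_filter, Finset.mem_Ioc] at hi ⊢
    omega
  have hsub : ((Finset.Ioc 0 (j - 1)).filter p₁) ∪ ((Finset.Ioc j k).filter p₂) ⊆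
      ((J.erase j).filter fun i => if i < j then p₁ i else p₂ i) ∪ (Finset.Icc 1 k \ J) := by
    intro i
    simp only [Finset.mem_union, Finset.mem_filter, Finset.mem_Ioc, Finset.mem_sdiff,
      Finset.mem_Icc, Finset.mem_erase]
    rintro (⟨hi, hp⟩ | ⟨hi, hp⟩)
    · by_cases hiJ : i ∈ J
      · exact Or.inl ⟨⟨by omega, hiJ⟩, by rwa [if_pos (by omega)]⟩
      · exact Or.inr ⟨by omega, hiJ⟩
    · by_cases hiJ : i ∈ J
      · exact Or.inl ⟨⟨by omega, hiJ⟩, by rwa [if_neg (by omega)]⟩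
      · exact Or.inr ⟨by omega, hiJ⟩
  have hc := (Finset.card_le_card hsub).trans (Finset.card_union_le _ _)
  rw [Finset.card_union_of_disjoint hdisj, Finset.card_sdiff_of_subset hJ, Nat.card_Icc] at hc
  have hdiv : k / N ≤ (j - 1) / N + (k - j) / N + 1 := by
    have e₁ := Nat.div_add_mod (j - 1) N
    have e₂ := Nat.div_add_mod (k - j) N
    have l₁ := Nat.mod_lt (j - 1) hN
    have l₂ := Nat.mod_lt (k - j) hN
    rw [← Nat.lt_succ_iff, Nat.div_lt_iff_lt_mul hN]
    have : ((j - 1) / N + (k - j) / N + 1).succ * N =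
        N * ((j - 1) / N) + N * ((k - j) / N) + 2 * N := by
      rw [Nat.succ_eq_add_one]; ring
    omega
  omega

/-- Key lemma, after Frisch. Let `{b'_i}_{i=1}^k` be a re-ordering of
`b₁, …, b_k` by increasing `P`-adic valuation and let `{u_i}_{i=1}^k` be a `P`-sequence
(i.e. `v_P(u_i - u_j) ≥ m ↔ q^{dm} ∣ i - j`). Then for every non-empty
`J ⊆ {1, …, k}` and all `h₁, h₂ ∈ A`,
`v_P(∏_{j∈J}(h₁ - u_j) - ∏_{j∈J}(h₂ - u_j)) ≥ v_P(h₁ - h₂) + Σ_{i=1}^{|J|-1} v_P(b'_i)`. -/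
theorem frisch_key_lemma (P : Polynomial F) (hPmonic : P.Monic) (hPirr : Irreducible P)
    (b : ℕ → Polynomial F) (hb : IsBSeq P b)
    (k : ℕ) (hk : 1 ≤ k)
    (b' : ℕ → Polynomial F) (π : Equiv.Perm (Fin k))
    (hπ : ∀ i : Fin k, b' ((i : ℕ) + 1) = b (((π i) : ℕ) + 1))
    (hmono : ∀ i j : ℕ, 1 ≤ i → i ≤ j → j ≤ k → vP P (b' i) ≤ vP P (b' j))
    (u : ℕ → Polynomial F)
    (hu : ∀ m i j : ℕ, 1 ≤ i → i ≤ k → 1 ≤ j → j ≤ k →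
      ((m : ℕ∞) ≤ vP P (u i - u j) ↔
        ((Fintype.card F ^ (P.natDegree * m) : ℕ) : ℤ) ∣ ((i : ℤ) - (j : ℤ))))
    (J : Finset ℕ) (hJ : J ⊆ Finset.Icc 1 k) (hJne : J.Nonempty)
    (h₁ h₂ : Polynomial F) :
    vP P (h₁ - h₂) + ∑ i ∈ Finset.Icc 1 (J.card - 1), vP P (b' i) ≤
      vP P (∏ j ∈ J, (h₁ - u j) - ∏ j ∈ J, (h₂ - u j)) := by
  classical
  set Q := Fintype.card F ^ P.natDegree with hQ
  have hQ1 : 1 < Q := Nat.one_lt_pow hPirr.natDegree_pos.ne' Fintype.one_lt_card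
  have hprime : Prime P := hPirr.prime
  have hnpos : 1 ≤ J.card := hJne.card_pos
  have hnk : J.card ≤ k := by simpa using Finset.card_le_card hJ
  have hb'dvd : ∀ i : Fin k, ∀ m : ℕ, (m : ℕ∞) ≤ vP P (b' (i + 1)) → Q ^ m ∣ (π i : ℕ) + 1 := by
    intro i m hm
    rw [hπ] at hm
    exact card_pow_dvd_of_le_vP hPmonic hb m _ hm
  have hcount : ∀ m : ℕ,
      ((Finset.Icc 1 k).filter fun i => (m : ℕ∞) ≤ vP P (b' i)).card ≤ k / Q ^ m := by
    intro m
    rw [← Nat.card_multiples k (Q ^ m)]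
    refine Finset.card_le_card_of_injOn
      (fun i => if hi : i - 1 < k then (π ⟨i - 1, hi⟩ : ℕ) else 0) ?_ ?_
    · intro i hi
      simp only [Finset.coe_filter, Finset.mem_Icc, Set.mem_ofPred_eq] at hi
      have hik : i - 1 < k := by omega
      have := hb'dvd ⟨i - 1, hik⟩ m (by simpa [Nat.sub_add_cancel hi.1.1] using hi.2)
      simpa [hik] using this
    · intro i hi j hj hij
      simp only [Finset.coe_filter, Finset.mem_Icc, Set.mem_ofPred_eq] at hi hj
      have hik : i - 1 < k := by omega
      have hjk : j - 1 < k := by omega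
      simp only [hik, hjk, dif_pos] at hij
      have := π.injective (Fin.ext hij)
      simp only [Fin.mk.injEq] at this
      omega
  have hbound : ∀ i ∈ Finset.Icc 1 (J.card - 1), vP P (b' i) ≤ (k : ℕ∞) := by
    intro i hi
    rw [Finset.mem_Icc] at hi
    by_contra! hlt
    have hik : i - 1 < k := by omega
    have hdvd := hb'dvd ⟨i - 1, hik⟩ k (by simpa [Nat.sub_add_cancel hi.1] using hlt.le)
    have h1 := Nat.le_of_dvd (Nat.succ_pos _) hdvd
    have h2 := Nat.lt_pow_self (n := k) hQ1
    have h3 := (π ⟨i - 1, hik⟩).isLt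
    omega
  have hwindow : ∀ (h : Polynomial F) (m c : ℕ), c + Q ^ m ≤ k →
      ∃ i ∈ Finset.Ioc c (c + Q ^ m), (m : ℕ∞) ≤ vP P (h - u i) := by
    intro h m c hc
    obtain ⟨i, hi, hd⟩ := exists_dvd_sub_of_card_le (hPmonic.pow m)
      (Finset.Ioc c (c + Q ^ m)) u
      (by rw [hPmonic.natDegree_pow, Nat.card_Ioc, hQ, ← pow_mul, mul_comm m]; omega)
      (fun i hi j hj hd => by
        rw [Finset.mem_Ioc] at hi hj
        have h1 := (hu m i j (by omega) (by omega) (by omega) (by omega)).1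
          (le_emultiplicity_of_pow_dvd hd)
        rw [pow_mul, ← hQ] at h1
        have h2 := Int.eq_zero_of_abs_lt_dvd h1 (by rw [abs_lt]; omega)
        omega) h
    exact ⟨i, hi, le_emultiplicity_of_pow_dvd hd⟩
  have hsplit : ∏ j ∈ J, (h₁ - u j) - ∏ j ∈ J, (h₂ - u j) =
      ∑ j ∈ J, (h₁ - h₂) * ∏ i ∈ J.erase j, ((if i < j then h₂ else h₁) - u i) := by
    have key := Finset.prod_sub_ordered J (fun j => h₁ - u j) (fun _ => h₁ - h₂)
    simp only [sub_right_comm h₁ _ (h₁ - h₂), sub_sub_cancel] at key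
    rw [key, sub_sub_cancel]
    refine Finset.sum_congr rfl fun j _ => ?_
    rw [mul_assoc, ← Finset.prod_filter_mul_prod_filter_not (J.erase j) (fun i => i < j)]
    congr 2
    · refine Finset.prod_congr ?_ fun i hi => ?_
      · ext i
        simp only [Finset.mem_filter, Finset.mem_erase]
        grind
      · rw [if_pos (Finset.mem_filter.1 hi).2]
    · refine Finset.prod_congr ?_ fun i hi => ?_
      · ext i
        simp only [Finset.mem_filter, Finset.mem_erase]
        grind
      · rw [if_neg (Finset.mem_filter.1 hi).2]
  rw [hsplit]
  refine le_emultiplicity_sum P J _ _ fun j hj => ?_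
  have hmul : vP P ((h₁ - h₂) * ∏ i ∈ J.erase j, ((if i < j then h₂ else h₁) - u i)) =
      vP P (h₁ - h₂) + ∑ i ∈ J.erase j, vP P ((if i < j then h₂ else h₁) - u i) := by
    unfold vP
    rw [emultiplicity_mul hprime, Finset.emultiplicity_prod hprime]
  refine le_of_le_of_eq ?_ hmul.symm
  gcongr vP P (h₁ - h₂) + ?_
  refine sum_le_sum_of_card_superlevel_le _ _ _ _ k hbound fun m => ?_
  calc _ ≤ ((Finset.Icc 1 k).filter fun i => (m : ℕ∞) ≤ vP P (b' i)).card - (k - J.card + 1) :=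
        card_filter_Icc_le_of_monotone (fun i => vP P (b' i)) hnpos hnk hmono m
    _ ≤ k / Q ^ m - (k - J.card + 1) := Nat.sub_le_sub_right (hcount m) _
    _ ≤ _ := div_sub_le_card_filter_switch (fun i => (m : ℕ∞) ≤ vP P (h₂ - u i))
        (fun i => (m : ℕ∞) ≤ vP P (h₁ - u i)) (pow_pos (by omega) m)
        (hwindow h₂ m) (hwindow h₁ m) hJ hj
    _ = _ := by
        congr 1
        refine Finset.filter_congr fun i _ => ?_
        split_ifs <;> rfl
end
end

section
/- Let P ∈ A be monic irreducible of degree d and μ(k) = ⌊(log_q k)/d⌋ for integers k ≥ 1. Then for every integer k ≥ 1 and all h₁, h₂ ∈ A, v_P(∏_{j=0}^{k−1}(h₁ − b_j) − ∏_{j=0}^{k−1}(h₂ − b_j)) ≥ v_P(h₁ − h₂) + Σ_{j≥1} ⌊k/q^{dj}⌋ − μ(k). -/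
open Polynomial

noncomputable section

variable {F : Type*} [Field F] [Fintype F]

/-- Any block of `q ^ (d * r)` consecutive terms starting at a multiple of `q ^ (d * r)`
meets every residue class modulo `P ^ r`. -/
theorem IsBSeq.exists_pow_dvd_sub {P : Polynomial F} (hP : P.Monic) {b : ℕ → Polynomial F}
    (hb : IsBSeq P b) (r c : ℕ) (h : Polynomial F) :
    ∃ j, j / Fintype.card F ^ (P.natDegree * r) = c ∧ P ^ r ∣ h - b j := by
  induction r generalizing h with
  | zero => exact ⟨c, by simp⟩
  | succ r ih =>
    obtain ⟨-, -, hbij, -, hrec⟩ := hb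
    have hdeg : (h %ₘ P).degree < (P.natDegree : WithBot ℕ) := by
      rw [← degree_eq_natDegree hP.ne_zero]
      exact degree_modByMonic_lt h hP
    obtain ⟨l, hl, hbl⟩ := hbij.surjOn hdeg
    rw [Set.mem_Iio] at hl
    have hQ : 0 < Fintype.card F ^ P.natDegree := by omega
    obtain ⟨j, hj, hdvd⟩ := ih (h /ₘ P)
    refine ⟨l + Fintype.card F ^ P.natDegree * j, ?_, ?_⟩
    · rw [mul_add, mul_one, add_comm (P.natDegree * r), pow_add, ← Nat.div_div_eq_div_mul,
        Nat.add_mul_div_left _ _ hQ, Nat.div_eq_of_lt hl, zero_add, hj]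
    · rw [hrec, Nat.add_mul_mod_self_left, Nat.mod_eq_of_lt hl, Nat.add_mul_div_left _ _ hQ,
        Nat.div_eq_of_lt hl, zero_add, hbl]
      have key : h - (h %ₘ P + P * b j) = P * (h /ₘ P - b j) := by
        linear_combination -(modByMonic_add_div h P)
      rw [key, pow_succ']
      exact mul_dvd_mul_left P hdvd

open Classical in
theorem IsBSeq.div_le_card_filter_pow_dvd {P : Polynomial F} (hP : P.Monic)
    {b : ℕ → Polynomial F} (hb : IsBSeq P b) (r k : ℕ) (h : Polynomial F) :
    k / Fintype.card F ^ (P.natDegree * r) ≤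
      ((Finset.range k).filter fun i => P ^ r ∣ h - b i).card := by
  choose j hj hdvd using fun c => hb.exists_pow_dvd_sub hP r c h
  rw [← Finset.card_range (k / _)]
  refine Finset.card_le_card_of_injOn j ?_ ?_
  · intro c hc
    rw [Finset.mem_coe, Finset.mem_range, ← hj c] at hc
    simp only [Finset.coe_filter, Finset.mem_range, Set.mem_ofPred_eq]
    exact ⟨lt_of_not_ge fun hle => absurd (Nat.div_le_div_right hle) (not_le.mpr hc), hdvd c⟩
  · intro c _ c' _ hcc
    rw [← hj c, hcc, hj c']

open Classical in
theorem pow_card_filter_pow_dvd_dvd {R : Type*} [CommMonoid R] (p a : R) (m : ℕ) :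
    p ^ ((Finset.Icc 1 m).filter fun r => p ^ r ∣ a).card ∣ a := by
  induction m with
  | zero => simp
  | succ m ih =>
    by_cases h : p ^ (m + 1) ∣ a
    · refine (pow_dvd_pow p ?_).trans h
      exact (Finset.card_filter_le _ _).trans (by simp)
    · rwa [← Finset.insert_Icc_right_eq_Icc_add_one (by omega), Finset.filter_insert, if_neg h]

open Classical in
/-- A product is divisible by `p ^ ∑ n r` as soon as, for each `r`, at least `n r` of its
factors are divisible by `p ^ r`. -/
theorem pow_sum_dvd_prod {R ι : Type*} [CommMonoid R] (p : R) (s : Finset ι) (g : ι → R) (m : ℕ)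
    (n : ℕ → ℕ) (hn : ∀ r ∈ Finset.Icc 1 m, n r ≤ (s.filter fun i => p ^ r ∣ g i).card) :
    p ^ ∑ r ∈ Finset.Icc 1 m, n r ∣ ∏ i ∈ s, g i := by
  refine (pow_dvd_pow p (Finset.sum_le_sum hn)).trans ?_
  have hswap : ∑ r ∈ Finset.Icc 1 m, (s.filter fun i => p ^ r ∣ g i).card =
      ∑ i ∈ s, ((Finset.Icc 1 m).filter fun r => p ^ r ∣ g i).card := by
    simp only [Finset.card_filter]
    exact Finset.sum_comm
  rw [hswap, ← Finset.prod_pow_eq_pow_sum]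
  exact Finset.prod_dvd_prod_of_dvd _ _ fun i _ => pow_card_filter_pow_dvd_dvd p (g i) m

/-- Telescoping form of the difference of two products. -/
theorem prod_range_sub_prod_range {R : Type*} [CommRing R] (f g : ℕ → R) (k : ℕ) :
    ∏ i ∈ Finset.range k, f i - ∏ i ∈ Finset.range k, g i =
      ∑ j ∈ Finset.range k,
        (f j - g j) * ∏ i ∈ (Finset.range k).erase j, if i < j then f i else g i := by
  let T : ℕ → R := fun j => ∏ i ∈ Finset.range k, if i < j then f i else g i
  have hk : T k = ∏ i ∈ Finset.range k, f i :=
    Finset.prod_congr rfl fun i hi => if_pos (Finset.mem_range.mp hi)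
  have h0 : T 0 = ∏ i ∈ Finset.range k, g i :=
    Finset.prod_congr rfl fun i _ => if_neg (Nat.not_lt_zero i)
  rw [← hk, ← h0, ← Finset.sum_range_sub]
  refine Finset.sum_congr rfl fun j hj => ?_
  have hsucc : T (j + 1) =
      f j * ∏ i ∈ (Finset.range k).erase j, if i < j then f i else g i := by
    change ∏ i ∈ Finset.range k, _ = _
    rw [← Finset.mul_prod_erase _ _ hj, if_pos j.lt_succ_self]
    congr 1
    refine Finset.prod_congr rfl fun i hi => ?_
    have := Finset.ne_of_mem_erase hi
    exact if_congr (by omega) rfl rfl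
  have hself : T j = g j * ∏ i ∈ (Finset.range k).erase j, if i < j then f i else g i := by
    change ∏ i ∈ Finset.range k, _ = _
    rw [← Finset.mul_prod_erase _ _ hj, if_neg (lt_irrefl j)]
  rw [hsucc, hself, sub_mul]

/-- Lemma. With `μ(k) = ⌊log_q k / d⌋`, for every integer `k ≥ 1`
and all `h₁, h₂ ∈ A`,
`v_P(∏_{j<k}(h₁ - b_j) - ∏_{j<k}(h₂ - b_j)) ≥ v_P(h₁ - h₂) + Σ_{j≥1} ⌊k/q^{dj}⌋ - μ(k)`.
(The sum `Σ_{j≥1} ⌊k/q^{dj}⌋` is written as `Σ_{j=1}^{k} ⌊k/q^{dj}⌋`; the further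
terms vanish.) -/
theorem valuation_prod_sub_prod (P : Polynomial F) (hPmonic : P.Monic)
    (hPirr : Irreducible P)
    (b : ℕ → Polynomial F) (hb : IsBSeq P b)
    (k : ℕ) (hk : 1 ≤ k) (h₁ h₂ : Polynomial F) :
    vP P (h₁ - h₂) +
        (((∑ j ∈ Finset.Icc 1 k, k / Fintype.card F ^ (P.natDegree * j))
          - Nat.log (Fintype.card F) k / P.natDegree : ℕ) : ℕ∞) ≤
      vP P (∏ j ∈ Finset.range k, (h₁ - b j) - ∏ j ∈ Finset.range k, (h₂ - b j)) := by
  classical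
  set q := Fintype.card F with hq
  set d := P.natDegree with hd
  set m := Nat.log q k / d with hm
  have hq1 : 1 < q := Fintype.one_lt_card
  have hd0 : 0 < d := hPirr.natDegree_pos
  have hone : ∀ r ∈ Finset.Icc 1 m, 1 ≤ k / q ^ (d * r) := by
    intro r hr
    have hlog : d * r ≤ Nat.log q k :=
      (Nat.mul_le_mul_left d (Finset.mem_Icc.mp hr).2).trans (Nat.mul_div_le _ _)
    exact Nat.div_pos (Nat.pow_le_of_le_log (by omega) hlog) (by positivity)
  have hmk : m ≤ k := (Nat.div_le_self _ _).trans (Nat.log_le_self q k)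
  have hsum : ∑ r ∈ Finset.Icc 1 k, k / q ^ (d * r) = ∑ r ∈ Finset.Icc 1 m, k / q ^ (d * r) := by
    refine (Finset.sum_subset (Finset.Icc_subset_Icc_right hmk) fun r hr hrm => ?_).symm
    rw [Finset.mem_Icc] at hr hrm
    have hmr : m < r := by omega
    rw [hm, Nat.div_lt_iff_lt_mul hd0, mul_comm] at hmr
    exact Nat.div_eq_of_lt (Nat.lt_pow_of_log_lt hq1 hmr)
  have hsplit : ∑ r ∈ Finset.Icc 1 m, (k / q ^ (d * r) - 1) + m =
      ∑ r ∈ Finset.Icc 1 m, k / q ^ (d * r) := by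
    rw [← Finset.sum_congr rfl fun r hr => Nat.sub_add_cancel (hone r hr), Finset.sum_add_distrib]
    simp
  rw [hsum, ← hsplit, Nat.add_sub_cancel]
  unfold vP
  by_cases hdvd : P ^ m ∣ h₁ - h₂
  · rw [prod_range_sub_prod_range]
    simp only [sub_sub_sub_cancel_right]
    rw [← Finset.mul_sum, emultiplicity_mul hPirr.prime]
    gcongr
    refine le_emultiplicity_of_pow_dvd (Finset.dvd_sum fun j _ => ?_)
    refine pow_sum_dvd_prod P _ _ m _ fun r hr => ?_
    have hx : P ^ r ∣ h₁ - h₂ := (pow_dvd_pow P (Finset.mem_Icc.mp hr).2).trans hdvd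
    have hiff : ∀ i, P ^ r ∣ (if i < j then h₁ - b i else h₂ - b i) ↔ P ^ r ∣ h₁ - b i := by
      intro i
      split_ifs
      · rfl
      · exact (dvd_iff_dvd_of_dvd_sub (by rwa [sub_sub_sub_cancel_right])).symm
    simp only [hiff]
    rw [Finset.filter_erase]
    exact (Nat.sub_le_sub_right (hb.div_le_card_filter_pow_dvd hPmonic r k h₁) 1).trans
      Finset.pred_card_le_card_erase
  · have hlt : emultiplicity P (h₁ - h₂) ≤ m := (emultiplicity_lt_iff_not_dvd.mpr hdvd).le
    calc _ ≤ (m : ℕ∞) + ((∑ r ∈ Finset.Icc 1 m, (k / q ^ (d * r) - 1) : ℕ) : ℕ∞) := by gcongr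
      _ = ((∑ r ∈ Finset.Icc 1 m, k / q ^ (d * r) : ℕ) : ℕ∞) := by
        rw [← hsplit, add_comm, Nat.cast_add]
      _ ≤ _ := le_emultiplicity_of_pow_dvd <| dvd_sub
        (pow_sum_dvd_prod P _ _ m _ fun r _ => hb.div_le_card_filter_pow_dvd hPmonic r k h₁)
        (pow_sum_dvd_prod P _ _ m _ fun r _ => hb.div_le_card_filter_pow_dvd hPmonic r k h₂)
end
end

section
/- Let P ∈ A be monic irreducible of degree d. The sequence {b_k}_{k=0}^∞ is a homogeneous P-sequence; that is, for all i, j, m ∈ ℕ: v_P(b_i − b_j) ≥ m if and only if q^{dm} divides i − j, and v_P(b_i) ≥ m if and only if q^{dm} divides i. -/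
open Polynomial

noncomputable section

variable {F : Type*} [Field F] [Fintype F]

theorem Int.mul_dvd_sub_iff_emod_eq_and_dvd_ediv_sub {N : ℤ} (hN : 0 < N) (M i j : ℤ) :
    N * M ∣ i - j ↔ i % N = j % N ∧ M ∣ i / N - j / N := by
  have key (h : i % N = j % N) : i - j = N * (i / N - j / N) := by
    linear_combination h - Int.emod_add_mul_ediv i N + Int.emod_add_mul_ediv j N
  constructor
  · intro h
    have hmod : i % N = j % N := Int.emod_eq_emod_iff_emod_sub_eq_zero.mpr
      (Int.emod_eq_zero_of_dvd ((dvd_mul_right N M).trans h))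
    refine ⟨hmod, ?_⟩
    rw [key hmod] at h
    exact (mul_dvd_mul_iff_left hN.ne').mp h
  · rintro ⟨hmod, h⟩
    rw [key hmod]
    exact mul_dvd_mul_left N h

namespace IsBSeq

variable {P : Polynomial F} {b : ℕ → Polynomial F}

theorem dvd_sub_iff_mod_eq (hP : P ≠ 0) (hb : IsBSeq P b) (i j : ℕ) :
    P ∣ b i - b j ↔
      i % Fintype.card F ^ P.natDegree = j % Fintype.card F ^ P.natDegree := by
  obtain ⟨-, -, hbij, -, hrec⟩ := hb
  have hN : 0 < Fintype.card F ^ P.natDegree := pow_pos Fintype.card_pos _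
  have hi := Nat.mod_lt i hN
  have hj := Nat.mod_lt j hN
  have hdvd : P ∣ b i - b j ↔ P ∣ b (i % Fintype.card F ^ P.natDegree) -
      b (j % Fintype.card F ^ P.natDegree) := by
    rw [hrec i, hrec j, add_sub_add_comm, ← mul_sub]
    exact dvd_add_left (dvd_mul_right _ _)
  rw [hdvd]
  refine ⟨fun h => hbij.injOn hi hj (sub_eq_zero.mp ?_), fun h => by simp [h]⟩
  refine eq_zero_of_dvd_of_degree_lt h ?_
  rw [degree_eq_natDegree hP]
  exact (degree_sub_le _ _).trans_lt (max_lt (hbij.mapsTo hi) (hbij.mapsTo hj))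

theorem pow_dvd_sub_iff (hP : P ≠ 0) (hb : IsBSeq P b) (i j m : ℕ) :
    P ^ m ∣ b i - b j ↔
      ((Fintype.card F ^ (P.natDegree * m) : ℕ) : ℤ) ∣ ((i : ℤ) - (j : ℤ)) := by
  induction m generalizing i j with
  | zero => simp
  | succ m ih =>
    have hN : (0 : ℤ) < ((Fintype.card F ^ P.natDegree : ℕ) : ℤ) :=
      mod_cast pow_pos Fintype.card_pos _
    rw [mul_add_one, pow_add (Fintype.card F), mul_comm (_ ^ (_ * m)), Nat.cast_mul,
      Int.mul_dvd_sub_iff_emod_eq_and_dvd_ediv_sub hN]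
    simp only [← Int.natCast_mod, ← Int.natCast_div, Nat.cast_inj]
    rw [← ih, ← hb.dvd_sub_iff_mod_eq hP]
    have key (h : P ∣ b i - b j) : b i - b j = P * (b (i / Fintype.card F ^ P.natDegree) -
        b (j / Fintype.card F ^ P.natDegree)) := by
      rw [hb.2.2.2.2 i, hb.2.2.2.2 j, (hb.dvd_sub_iff_mod_eq hP i j).mp h]
      ring
    constructor
    · intro h
      have hdvd : P ∣ b i - b j := (dvd_pow_self P m.succ_ne_zero).trans h
      rw [key hdvd, pow_succ'] at h
      exact ⟨hdvd, (mul_dvd_mul_iff_left hP).mp h⟩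
    · rintro ⟨hdvd, h⟩
      rw [key hdvd, pow_succ']
      exact mul_dvd_mul_left P h

end IsBSeq

/-- the sequence `{b_k}` is a homogeneous `P`-sequence: for all
`i, j, m ∈ ℕ`, `v_P(b_i - b_j) ≥ m ↔ q^{dm} ∣ i - j`, and `v_P(b_i) ≥ m ↔ q^{dm} ∣ i`. -/
theorem bseq_is_homogeneous_PSeq (P : Polynomial F) (hPmonic : P.Monic)
    (hPirr : Irreducible P)
    (b : ℕ → Polynomial F) (hb : IsBSeq P b) :
    (∀ i j m : ℕ,
      (m : ℕ∞) ≤ vP P (b i - b j) ↔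
        ((Fintype.card F ^ (P.natDegree * m) : ℕ) : ℤ) ∣ ((i : ℤ) - (j : ℤ))) ∧
    (∀ i m : ℕ,
      (m : ℕ∞) ≤ vP P (b i) ↔ Fintype.card F ^ (P.natDegree * m) ∣ i) := by
  have hdiff (i j m : ℕ) : (m : ℕ∞) ≤ vP P (b i - b j) ↔
      ((Fintype.card F ^ (P.natDegree * m) : ℕ) : ℤ) ∣ ((i : ℤ) - (j : ℤ)) := by
    rw [vP, ← pow_dvd_iff_le_emultiplicity, hb.pow_dvd_sub_iff hPirr.ne_zero]
  refine ⟨hdiff, fun i m => ?_⟩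
  have h := hdiff i 0 m
  rwa [hb.1, sub_zero, Nat.cast_zero, sub_zero, Int.natCast_dvd_natCast] at h
end
end
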